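/- arXiv:2601.05863 — 2 statements merged into one kernel-verified Lean document; each statement's English description precedes it below -/
import Mathlib

section
/- Let Z be a compact subset of the real projective plane ℝP² (the projectivization of ℝ³ with its quotient topology) and let Φ : Z × [0,∞) → Z be a continuous semiflow. If z ∈ Z is recurrent with respect to Φ, then z is either a fixed point of Φ or a periodic point of Φ. -/
open scoped NNReal
open Filter Topology

/-- The real projective plane: one-dimensional subspaces of `ℝ³`, with the quotient
topology induced from `ℝ³ ∖ {0}`. -/
noncomputable instance : TopologicalSpace (Projectivization ℝ (EuclideanSpace ℝ (Fin 3))) :=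
  inferInstanceAs (TopologicalSpace (Quotient _))

/-- A curve `g` on `[0, ∞)` whose forward pieces are shadowed by every return of the curve,
uniformly over bounded times. -/
def Shadowing {F : Type*} [NormedAddCommGroup F] (g : ℝ → F) : Prop :=
  ∀ T > 0, ∀ ε > 0, ∃ δ > 0, ∀ s ∈ Set.Icc 0 T, ∀ y ≥ 0, ‖g y - g s‖ < δ →
    ∀ r ∈ Set.Icc 0 T, ‖g (y + r) - g (s + r)‖ < ε

/-- A continuous determination `θ s t` of the argument of `g t - g s` for `0 ≤ s < t`. -/
structure IsAngleLift (g : ℝ → ℂ) (θ : ℝ → ℝ → ℝ) : Prop where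
  continuousOn : ContinuousOn (Function.uncurry θ) {p | 0 ≤ p.1 ∧ p.1 < p.2}
  coe_eq : ∀ s t, 0 ≤ s → s < t → (θ s t : Real.Angle) = ((g t - g s).arg : Real.Angle)

theorem exists_isAngleLift {g : ℝ → ℂ} (hg : Continuous g) (hinj : Set.InjOn g (Set.Ici 0)) :
    ∃ θ, IsAngleLift g θ := by
  have hne : ∀ p : ℝ × ℝ, g (max p.1 0 + Real.exp p.2) - g (max p.1 0) ≠ 0 := by
    intro p h
    have hm : (0 : ℝ) ≤ max p.1 0 := le_max_right _ _
    have := hinj (Set.mem_Ici.2 (by positivity)) (Set.mem_Ici.2 hm) (sub_eq_zero.1 h)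
    have := Real.exp_pos p.2
    linarith
  let F : C(ℝ × ℝ, {z : ℂ // z ≠ 0}) :=
    ⟨fun p => ⟨g (max p.1 0 + Real.exp p.2) - g (max p.1 0), hne p⟩, by fun_prop⟩
  obtain ⟨L, ⟨-, hL⟩, -⟩ := Complex.isCoveringMap_exp.existsUnique_continuousMap_lifts F (0, 0)
    (Complex.log (F (0, 0)).1) (Subtype.ext (Complex.exp_log (F (0, 0)).2))
  refine ⟨fun s t => (L (s, Real.log (t - s))).im, ?_, ?_⟩
  · have : ContinuousOn (fun p : ℝ × ℝ => (p.1, Real.log (p.2 - p.1)))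
        {p | 0 ≤ p.1 ∧ p.1 < p.2} := by
      refine continuousOn_fst.prodMk (ContinuousOn.log (by fun_prop) ?_)
      intro p hp
      exact (sub_pos.2 hp.2).ne'
    exact Complex.continuous_im.comp_continuousOn (L.continuous.comp_continuousOn this)
  · intro s t hs hst
    have h1 := congrArg Subtype.val (congrFun hL (s, Real.log (t - s)))
    simp only [Function.comp_apply, F, ContinuousMap.coe_mk, max_eq_left hs,
      Real.exp_log (sub_pos.2 hst), add_sub_cancel] at h1
    rw [← h1, Complex.arg_exp, Real.Angle.coe_toIocMod]

theorem exists_eq_arg_add {X : Type*} [TopologicalSpace X] {S : Set X} (hS : IsPreconnected S)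
    {f : X → ℂ} {φ : X → ℝ} (hf : ContinuousOn f S) (hφ : ContinuousOn φ S)
    (hs : ∀ x ∈ S, f x ∈ Complex.slitPlane)
    (h : ∀ x ∈ S, (φ x : Real.Angle) = ((f x).arg : Real.Angle)) :
    ∃ k : ℤ, ∀ x ∈ S, φ x = (f x).arg + 2 * Real.pi * k := by
  have hk : ∀ x ∈ S, ∃ k : ℤ, φ x - (f x).arg = 2 * Real.pi * k := fun x hx =>
    Real.Angle.angle_eq_iff_two_pi_dvd_sub.1 (h x hx)
  rcases S.eq_empty_or_nonempty with rfl | ⟨x₀, hx₀⟩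
  · exact ⟨0, by simp⟩
  obtain ⟨k, hk0⟩ := hk x₀ hx₀
  have hc : ContinuousOn (fun x => (φ x - (f x).arg) / (2 * Real.pi)) S :=
    (hφ.sub fun x hx => (Complex.continuousAt_arg (hs x hx)).comp_continuousWithinAt
      (hf x hx)).div_const _
  have hT : Set.MapsTo (fun x => (φ x - (f x).arg) / (2 * Real.pi)) S
      (Set.range ((↑) : ℤ → ℝ)) := by
    intro x hx
    obtain ⟨j, hj⟩ := hk x hx
    exact ⟨j, by simp only [hj]; field_simp⟩
  have hd : DiscreteTopology (Set.range ((↑) : ℤ → ℝ)) :=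
    (Int.isClosedEmbedding_coe_real.isEmbedding.toHomeomorph).symm.isEmbedding.discreteTopology
  refine ⟨k, fun x hx => ?_⟩
  have := hS.constant_of_mapsTo ⟨hd⟩ hc hT hx hx₀
  simp only [hk0] at this
  field_simp at this
  linarith

theorem exists_abs_arg_le {η : ℝ} (hη : 0 < η) :
    ∃ κ > 0, κ < 1 ∧ ∀ w : ℂ, ‖w - 1‖ ≤ κ → |w.arg| ≤ η := by
  have hc := Complex.continuousAt_arg Complex.one_mem_slitPlane
  obtain ⟨δ, hδ, h⟩ := Metric.continuousAt_iff.1 hc η hη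
  refine ⟨min (δ / 2) (1 / 2), by positivity, ?_, fun w hw => ?_⟩
  · exact lt_of_le_of_lt (min_le_right _ _) (by norm_num)
  · have h1 := h (x := w) (by
      rw [dist_eq_norm]
      exact lt_of_le_of_lt (hw.trans (min_le_left _ _)) (by linarith))
    rw [Complex.arg_one, Real.dist_eq, sub_zero] at h1
    exact h1.le

/-- Arguments of two nearby nonvanishing functions differ by an almost constant multiple
of `2π`. -/
theorem exists_forall_abs_sub_le {η κ : ℝ} (hκ : κ < 1)
    (hκη : ∀ w : ℂ, ‖w - 1‖ ≤ κ → |w.arg| ≤ η)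
    {X : Type*} [TopologicalSpace X] {S : Set X} (hS : IsPreconnected S)
    {f₁ f₂ : X → ℂ} {φ₁ φ₂ : X → ℝ} (hf₁ : ContinuousOn f₁ S) (hf₂ : ContinuousOn f₂ S)
    (hφ₁ : ContinuousOn φ₁ S) (hφ₂ : ContinuousOn φ₂ S)
    (h₁ : ∀ x ∈ S, (φ₁ x : Real.Angle) = ((f₁ x).arg : Real.Angle))
    (h₂ : ∀ x ∈ S, (φ₂ x : Real.Angle) = ((f₂ x).arg : Real.Angle))
    (hne : ∀ x ∈ S, f₂ x ≠ 0) (hd : ∀ x ∈ S, ‖f₁ x - f₂ x‖ ≤ κ * ‖f₂ x‖) :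
    ∃ k : ℤ, ∀ x ∈ S, |φ₁ x - φ₂ x - 2 * Real.pi * k| ≤ η := by
  have hq : ∀ x ∈ S, ‖f₁ x / f₂ x - 1‖ ≤ κ := by
    intro x hx
    have h0 : 0 < ‖f₂ x‖ := norm_pos_iff.2 (hne x hx)
    rw [div_sub_one (hne x hx), norm_div, div_le_iff₀ h0]
    exact hd x hx
  have hre : ∀ x ∈ S, 0 < (f₁ x / f₂ x).re := by
    intro x hx
    have := (Complex.abs_re_le_norm (f₁ x / f₂ x - 1)).trans (hq x hx)
    rw [Complex.sub_re, Complex.one_re, abs_le] at this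
    linarith
  obtain ⟨k, hk⟩ := exists_eq_arg_add hS (f := fun x => f₁ x / f₂ x) (φ := fun x => φ₁ x - φ₂ x)
    (hf₁.div hf₂ hne) (hφ₁.sub hφ₂) (fun x hx => Or.inl (hre x hx)) (by
      intro x hx
      have hne₁ : f₁ x ≠ 0 := by
        intro h
        have := hre x hx
        simp [h] at this
      rw [Real.Angle.coe_sub, h₁ x hx, h₂ x hx, Complex.arg_div_coe_angle hne₁ (hne x hx)])
  refine ⟨k, fun x hx => ?_⟩
  have := hκη _ (hq x hx)
  rwa [hk x hx, add_sub_cancel_right]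

theorem IsAngleLift.comp {g : ℝ → ℂ} {θ : ℝ → ℝ → ℝ} (hθ : IsAngleLift g θ)
    {X : Type*} [TopologicalSpace X] {S : Set X} {a b : X → ℝ} (ha : ContinuousOn a S)
    (hb : ContinuousOn b S) (h : ∀ x ∈ S, 0 ≤ a x ∧ a x < b x) :
    ContinuousOn (fun x => θ (a x) (b x)) S :=
  hθ.continuousOn.comp (ha.prodMk hb) h

theorem IsAngleLift.coe_add_pi {g : ℝ → ℂ} {θ : ℝ → ℝ → ℝ} (hθ : IsAngleLift g θ)
    (hinj : Set.InjOn g (Set.Ici 0)) {s t : ℝ} (hs : 0 ≤ s) (hst : s < t) :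
    ((θ s t + Real.pi : ℝ) : Real.Angle) = ((g s - g t).arg : Real.Angle) := by
  have hne : g t - g s ≠ 0 := fun h =>
    hst.ne' (hinj (Set.mem_Ici.2 (hs.trans hst.le)) (Set.mem_Ici.2 hs) (sub_eq_zero.1 h))
  rw [Real.Angle.coe_add, hθ.coe_eq s t hs hst, ← Complex.arg_neg_coe_angle hne, neg_sub]

theorem IsAngleLift.exists_abs_sub_le {g : ℝ → ℂ} {θ : ℝ → ℝ → ℝ} (hθ : IsAngleLift g θ)
    (hg : Continuous g) (hinj : Set.InjOn g (Set.Ici 0)) {η κ : ℝ} (hκ : κ < 1)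
    (hκη : ∀ w : ℂ, ‖w - 1‖ ≤ κ → |w.arg| ≤ η)
    {X : Type*} [TopologicalSpace X] {S : Set X} (hS : IsPreconnected S) {a b a' b' : X → ℝ}
    (ha : ContinuousOn a S) (hb : ContinuousOn b S) (ha' : ContinuousOn a' S)
    (hb' : ContinuousOn b' S) (h : ∀ x ∈ S, 0 ≤ a x ∧ a x < b x)
    (h' : ∀ x ∈ S, 0 ≤ a' x ∧ a' x < b' x)
    (hd : ∀ x ∈ S, ‖(g (b x) - g (a x)) - (g (b' x) - g (a' x))‖ ≤ κ * ‖g (b' x) - g (a' x)‖) :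
    ∃ k : ℤ, ∀ x ∈ S, |θ (a x) (b x) - θ (a' x) (b' x) - 2 * Real.pi * k| ≤ η := by
  refine exists_forall_abs_sub_le hκ hκη hS
    ((hg.comp_continuousOn hb).sub (hg.comp_continuousOn ha))
    ((hg.comp_continuousOn hb').sub (hg.comp_continuousOn ha'))
    (hθ.comp ha hb h) (hθ.comp ha' hb' h') (fun x hx => hθ.coe_eq _ _ (h x hx).1 (h x hx).2)
    (fun x hx => hθ.coe_eq _ _ (h' x hx).1 (h' x hx).2) (fun x hx h0 => ?_) hd
  have h2 := h' x hx
  exact h2.2.ne' (hinj (Set.mem_Ici.2 (h2.1.trans h2.2.le)) (Set.mem_Ici.2 h2.1)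
    (sub_eq_zero.1 h0))

theorem IsAngleLift.exists_abs_sub_add_pi_le {g : ℝ → ℂ} {θ : ℝ → ℝ → ℝ}
    (hθ : IsAngleLift g θ) (hg : Continuous g) (hinj : Set.InjOn g (Set.Ici 0)) {η κ : ℝ}
    (hκ : κ < 1) (hκη : ∀ w : ℂ, ‖w - 1‖ ≤ κ → |w.arg| ≤ η)
    {X : Type*} [TopologicalSpace X] {S : Set X} (hS : IsPreconnected S) {a b a' b' : X → ℝ}
    (ha : ContinuousOn a S) (hb : ContinuousOn b S) (ha' : ContinuousOn a' S)
    (hb' : ContinuousOn b' S) (h : ∀ x ∈ S, 0 ≤ a x ∧ a x < b x)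
    (h' : ∀ x ∈ S, 0 ≤ a' x ∧ a' x < b' x)
    (hd : ∀ x ∈ S, ‖(g (b x) - g (a x)) - (g (a' x) - g (b' x))‖ ≤ κ * ‖g (a' x) - g (b' x)‖) :
    ∃ k : ℤ, ∀ x ∈ S,
      |θ (a x) (b x) - (θ (a' x) (b' x) + Real.pi) - 2 * Real.pi * k| ≤ η := by
  refine exists_forall_abs_sub_le hκ hκη hS
    ((hg.comp_continuousOn hb).sub (hg.comp_continuousOn ha))
    ((hg.comp_continuousOn ha').sub (hg.comp_continuousOn hb'))
    (hθ.comp ha hb h) ((hθ.comp ha' hb' h').add continuousOn_const)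
    (fun x hx => hθ.coe_eq _ _ (h x hx).1 (h x hx).2)
    (fun x hx => hθ.coe_add_pi hinj (h' x hx).1 (h' x hx).2) (fun x hx h0 => ?_) hd
  have h2 := h' x hx
  exact h2.2.ne (hinj (Set.mem_Ici.2 h2.1) (Set.mem_Ici.2 (h2.1.trans h2.2.le))
    (sub_eq_zero.1 h0))

/-- An injective curve keeps distinct times uniformly apart. -/
theorem exists_forall_le_norm_sub {g : ℝ → ℂ} (hg : Continuous g)
    (hinj : Set.InjOn g (Set.Ici 0)) (R : ℝ) {h : ℝ} (hh : 0 < h) :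
    ∃ ρ > 0, ∀ s ∈ Set.Icc 0 R, ∀ t ∈ Set.Icc 0 R, h ≤ |s - t| → ρ ≤ ‖g s - g t‖ := by
  have hc : IsCompact ((Set.Icc 0 R ×ˢ Set.Icc 0 R) ∩ {q : ℝ × ℝ | h ≤ |q.1 - q.2|}) :=
    (isCompact_Icc.prod isCompact_Icc).inter_right
      (isClosed_le continuous_const (by fun_prop))
  rcases Set.eq_empty_or_nonempty
    ((Set.Icc 0 R ×ˢ Set.Icc 0 R) ∩ {q : ℝ × ℝ | h ≤ |q.1 - q.2|}) with he | hne
  · refine ⟨1, one_pos, fun s hs t ht hst => ?_⟩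
    have : (s, t) ∈ ((Set.Icc 0 R ×ˢ Set.Icc 0 R) ∩ {q : ℝ × ℝ | h ≤ |q.1 - q.2|}) :=
      ⟨⟨hs, ht⟩, hst⟩
    rw [he] at this
    exact this.elim
  · obtain ⟨q, hq, hmin⟩ := hc.exists_isMinOn hne
      (f := fun q : ℝ × ℝ => ‖g q.1 - g q.2‖) (by fun_prop)
    refine ⟨_, norm_pos_iff.2 fun h0 => ?_, fun s hs t ht hst => hmin (a := (s, t)) ⟨⟨hs, ht⟩, hst⟩⟩
    have := hinj (Set.mem_Ici.2 hq.1.1.1) (Set.mem_Ici.2 hq.1.2.1) (sub_eq_zero.1 h0)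
    have h2 := hq.2
    rw [Set.mem_ofPred_eq, this, sub_self, abs_zero] at h2
    linarith

/-- At time `x` the curve follows its initial piece on `[0, T]` up to `ε`. -/
def Follows (g : ℝ → ℂ) (T ε x : ℝ) : Prop :=
  ∀ r ∈ Set.Icc 0 T, ‖g (x + r) - g r‖ ≤ ε

theorem Follows.exists_abs_sub_le {g : ℝ → ℂ} {θ : ℝ → ℝ → ℝ} (hθ : IsAngleLift g θ)
    (hg : Continuous g) (hinj : Set.InjOn g (Set.Ici 0)) {η κ : ℝ} (hκ : κ < 1)
    (hκη : ∀ w : ℂ, ‖w - 1‖ ≤ κ → |w.arg| ≤ η) (hκ0 : 0 < κ)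
    {T h ρ ε : ℝ} (hh : 0 < h)
    (hρ : ∀ s ∈ Set.Icc 0 T, ∀ t ∈ Set.Icc 0 T, h ≤ |s - t| → ρ ≤ ‖g s - g t‖)
    (hε : 2 * ε ≤ κ * ρ) {x y : ℝ} (hx : 0 ≤ x) (hxy : x + T < y)
    (cx : Follows g T ε x) (cy : Follows g T ε y) :
    (∃ k : ℤ, ∀ s t, 0 ≤ s → s + h ≤ t → t ≤ T →
      |θ (x + s) (y + t) - θ s t - 2 * Real.pi * k| ≤ η) ∧
    ∃ k : ℤ, ∀ s t, 0 ≤ t → t + h ≤ s → s ≤ T →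
      |θ (x + s) (y + t) - (θ t s + Real.pi) - 2 * Real.pi * k| ≤ η := by
  have key : ∀ s ∈ Set.Icc 0 T, ∀ t ∈ Set.Icc 0 T, h ≤ |s - t| →
      ‖(g (y + t) - g (x + s)) - (g t - g s)‖ ≤ κ * ‖g t - g s‖ := by
    intro s hs t ht hst
    have h1 := hρ s hs t ht hst
    have h2 : ‖(g (y + t) - g t) - (g (x + s) - g s)‖ ≤ ε + ε :=
      (norm_sub_le _ _).trans (add_le_add (cy t ht) (cx s hs))
    rw [norm_sub_rev (g s)] at h1
    calc _ = ‖(g (y + t) - g t) - (g (x + s) - g s)‖ := by congr 1; ring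
      _ ≤ κ * ρ := by linarith
      _ ≤ _ := by gcongr
  have hS : Convex ℝ {p : ℝ × ℝ | 0 ≤ p.1 ∧ p.1 + h ≤ p.2 ∧ p.2 ≤ T} := by
    rintro ⟨a, b⟩ ⟨h1, h2, h3⟩ ⟨a', b'⟩ ⟨h1', h2', h3'⟩ u v hu hv huv
    have e : ∀ w, u * w + v * w = w := fun w => by rw [← add_mul, huv, one_mul]
    have j1 := mul_le_mul_of_nonneg_left h2 hu
    have j2 := mul_le_mul_of_nonneg_left h2' hv
    have j3 := mul_le_mul_of_nonneg_left h3 hu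
    have j4 := mul_le_mul_of_nonneg_left h3' hv
    have j5 := mul_nonneg hu h1
    have j6 := mul_nonneg hv h1'
    refine ⟨?_, ?_, ?_⟩ <;> simp only [Prod.smul_mk, Prod.mk_add_mk, smul_eq_mul] at *
    · linarith
    · linarith [e h]
    · linarith [e T]
  constructor
  · obtain ⟨k, hk⟩ := hθ.exists_abs_sub_le hg hinj hκ hκη hS.isPreconnected
      (a := fun p => x + p.1) (b := fun p => y + p.2) (a' := fun p => p.1) (b' := fun p => p.2)
      (by fun_prop) (by fun_prop) (by fun_prop) (by fun_prop)
      (fun p hp => ⟨by linarith [hp.1], by linarith [hp.1, hp.2.1, hp.2.2]⟩)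
      (fun p hp => ⟨hp.1, by linarith [hp.2.1]⟩)
      (fun p hp => key _ ⟨hp.1, by linarith [hp.2.1, hp.2.2]⟩ _
        ⟨by linarith [hp.1, hp.2.1], hp.2.2⟩ (by
          rw [abs_sub_comm]; exact le_trans (by linarith [hp.2.1]) (le_abs_self _)))
    exact ⟨k, fun s t h1 h2 h3 => hk (s, t) ⟨h1, h2, h3⟩⟩
  · obtain ⟨k, hk⟩ := hθ.exists_abs_sub_add_pi_le hg hinj hκ hκη hS.isPreconnected
      (a := fun p => x + p.2) (b := fun p => y + p.1) (a' := fun p => p.1) (b' := fun p => p.2)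
      (by fun_prop) (by fun_prop) (by fun_prop) (by fun_prop)
      (fun p hp => ⟨by linarith [hp.1, hp.2.1], by linarith [hp.1, hp.2.1, hp.2.2]⟩)
      (fun p hp => ⟨hp.1, by linarith [hp.2.1]⟩)
      (fun p hp => key _ ⟨by linarith [hp.1, hp.2.1], hp.2.2⟩ _
        ⟨hp.1, by linarith [hp.2.1, hp.2.2]⟩
        (le_trans (by linarith [hp.2.1]) (le_abs_self _)))
    exact ⟨k, fun s t h1 h2 h3 => hk (t, s) ⟨h1, h2, h3⟩⟩

theorem mem_slitPlane_of_re_nonneg {w : ℂ} (h0 : w ≠ 0) (h : 0 ≤ w.re) :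
    w ∈ Complex.slitPlane := by
  rw [Complex.mem_slitPlane_iff]
  by_contra! h1
  exact h0 (Complex.ext (le_antisymm h1.1 h) h1.2)

theorem int_eq_of_abs_sub_lt {a b : ℤ} (h : |2 * Real.pi * a - 2 * Real.pi * b| < 2 * Real.pi) :
    a = b := by
  rw [← mul_sub, abs_mul, abs_of_pos Real.two_pi_pos] at h
  have h1 : |(a : ℝ) - b| < 1 := by
    by_contra! h2
    nlinarith [Real.two_pi_pos]
  have h2 : |a - b| < 1 := by exact_mod_cast h1
  have := Int.abs_lt_one_iff.1 h2
  omega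

/-- Two returns of the curve are compared through the height `re g` they reach; the winding of the
later return about the earlier one depends only on the outcome. -/
theorem exists_winding_dichotomy {g : ℝ → ℂ} {θ : ℝ → ℝ → ℝ} (hθ : IsAngleLift g θ)
    (hg : Continuous g) (hinj : Set.InjOn g (Set.Ici 0)) {T s₀ : ℝ} (hs₀ : 0 < s₀) (hT : s₀ < T)
    (hmax : ∀ s ∈ Set.Icc 0 T, s ≠ s₀ → (g s).re < (g s₀).re) :
    ∃ A : ℝ, ∃ c : ℤ, c ≠ 0 ∧ ∃ ε > 0, ∀ x y, 0 ≤ x → x + T < y → Follows g T ε x →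
      Follows g T ε y →
      ((∃ t ∈ Set.Icc 0 T, ∀ s ∈ Set.Icc 0 T, (g (x + s)).re ≤ (g (y + t)).re) →
        |θ (x + s₀) (y + T) - θ (x + s₀) y - A| ≤ 1 / 5) ∧
      ((∃ s ∈ Set.Icc 0 T, ∀ t ∈ Set.Icc 0 T, (g (y + t)).re ≤ (g (x + s)).re) →
        |θ (x + s₀) (y + T) - θ (x + s₀) y - (A + 2 * Real.pi * c)| ≤ 1 / 5) := by
  have hpi := Real.pi_gt_three
  obtain ⟨κ, hκ0, hκ, hκη⟩ := exists_abs_arg_le (η := 1 / 10) (by norm_num)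
  have hT0 : 0 < T := hs₀.trans hT
  have hm0 : (0 : ℝ) ∈ Set.Icc 0 T := ⟨le_rfl, hT0.le⟩
  have hmT : T ∈ Set.Icc 0 T := ⟨hT0.le, le_rfl⟩
  have hms : s₀ ∈ Set.Icc 0 T := ⟨hs₀.le, hT.le⟩
  have hnear : ∀ r ∈ Set.Icc 0 T, r ≠ s₀ → ∃ τ > 0, ∀ w : ℂ, ‖w - (g s₀ - g r)‖ ≤ τ →
      |w.arg - (g s₀ - g r).arg| ≤ 1 / 10 := by
    intro r hr hne
    have hsl : g s₀ - g r ∈ Complex.slitPlane := by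
      left
      rw [Complex.sub_re]
      linarith [hmax r hr hne]
    obtain ⟨τ, hτ, h⟩ := Metric.continuousAt_iff.1 (Complex.continuousAt_arg hsl) (1 / 10)
      (by norm_num)
    refine ⟨τ / 2, by positivity, fun w hw => ?_⟩
    have := h (x := w) (by rw [dist_eq_norm]; linarith)
    rw [Real.dist_eq] at this
    exact this.le
  obtain ⟨τ₀, hτ₀, harg₀⟩ := hnear 0 hm0 hs₀.ne
  obtain ⟨τ₁, hτ₁, harg₁⟩ := hnear T hmT hT.ne'
  have hdom : ∀ᶠ t in 𝓝 s₀, 0 < t ∧ t < T :=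
    (lt_mem_nhds hs₀).and (gt_mem_nhds hT)
  have hopen : IsOpen {p : ℝ × ℝ | 0 < p.1 ∧ p.1 < p.2} :=
    (isOpen_lt continuous_const continuous_fst).inter (isOpen_lt continuous_fst continuous_snd)
  have hev₁ : ∀ᶠ t in 𝓝 s₀, |θ 0 t - θ 0 s₀| < 1 / 10 := by
    have hc : ContinuousOn (fun t => θ 0 t) (Set.Ioi 0) :=
      hθ.comp continuousOn_const continuousOn_id fun t ht => ⟨le_rfl, ht⟩
    have := Metric.tendsto_nhds.1 (hc.continuousAt (Ioi_mem_nhds hs₀)) (1 / 10) (by norm_num)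
    simpa only [Real.dist_eq] using this
  have hev₂ : ∀ᶠ t in 𝓝 s₀, |θ t T - θ s₀ T| < 1 / 10 := by
    have hc : ContinuousOn (fun t => θ t T) (Set.Ioo 0 T) :=
      hθ.comp continuousOn_id continuousOn_const fun t ht => ⟨ht.1.le, ht.2⟩
    have := Metric.tendsto_nhds.1 (hc.continuousAt (Ioo_mem_nhds hs₀ hT)) (1 / 10) (by norm_num)
    simpa only [Real.dist_eq] using this
  have hev₃ : ∀ᶠ t in 𝓝 s₀, ‖g t - g s₀‖ < min τ₀ τ₁ / 2 := by
    have := Metric.tendsto_nhds.1 (hg.continuousAt (x := s₀)) (min τ₀ τ₁ / 2) (by positivity)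
    simpa only [dist_eq_norm] using this
  obtain ⟨h₁, hh₁, hball⟩ := Metric.eventually_nhds_iff.1 (hev₁.and (hev₂.and hev₃))
  obtain ⟨h, hh, hhh₁, hhs, hhT⟩ : ∃ h > 0, h < h₁ ∧ 3 * h ≤ s₀ ∧ 3 * h ≤ T - s₀ := by
    have : 0 < T - s₀ := sub_pos.2 hT
    refine ⟨min (h₁ / 2) (min (s₀ / 3) ((T - s₀) / 3)), by positivity, ?_, ?_, ?_⟩
    · exact (min_le_left _ _).trans_lt (by linarith)
    · have := (min_le_right (h₁ / 2) _).trans (min_le_left (s₀ / 3) ((T - s₀) / 3))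
      linarith
    · have := (min_le_right (h₁ / 2) _).trans (min_le_right (s₀ / 3) ((T - s₀) / 3))
      linarith
  obtain ⟨ρ, hρ, hρh⟩ := exists_forall_le_norm_sub hg hinj T hh
  obtain ⟨μ, hμ, hgap⟩ : ∃ μ > 0, ∀ t ∈ Set.Icc 0 T, (g s₀).re - μ < (g t).re → |t - s₀| < h := by
    have hc : IsCompact (Set.Icc 0 T ∩ {t | h ≤ |t - s₀|}) :=
      isCompact_Icc.inter_right (isClosed_le continuous_const (by fun_prop))
    have hne : (Set.Icc 0 T ∩ {t | h ≤ |t - s₀|}).Nonempty :=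
      ⟨0, hm0, show h ≤ |0 - s₀| by rw [zero_sub, abs_neg, abs_of_pos hs₀]; linarith⟩
    obtain ⟨q, hq, hqm⟩ := hc.exists_isMaxOn hne (f := fun t => (g t).re) (by fun_prop)
    refine ⟨(g s₀).re - (g q).re, sub_pos.2 (hmax q hq.1 ?_), fun t ht h1 => ?_⟩
    · rintro rfl
      have : h ≤ |q - q| := hq.2
      rw [sub_self, abs_zero] at this
      linarith
    · by_contra! h2
      have : (g t).re ≤ (g q).re := hqm ⟨ht, h2⟩
      linarith
  obtain ⟨K, hK⟩ : ∃ K : ℤ, (g s₀ - g 0).arg - (g s₀ - g T).arg - θ 0 s₀ + θ s₀ T + Real.pi =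
      2 * Real.pi * K := by
    have h1 := hθ.coe_eq 0 s₀ le_rfl hs₀
    have h2 := hθ.coe_add_pi hinj hs₀.le hT
    obtain ⟨k, hk⟩ := Real.Angle.angle_eq_iff_two_pi_dvd_sub.1 h1
    obtain ⟨l, hl⟩ := Real.Angle.angle_eq_iff_two_pi_dvd_sub.1 h2
    refine ⟨l - k, ?_⟩
    push_cast
    linarith
  obtain ⟨ε, hε, hεκ, hεμ, hετ₀, hετ₁⟩ : ∃ ε > 0, 2 * ε ≤ κ * ρ ∧ 2 * ε < μ ∧ 2 * ε ≤ τ₀ / 2 ∧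
      2 * ε ≤ τ₁ / 2 := by
    refine ⟨min (min (κ * ρ / 2) (μ / 4)) (min (τ₀ / 4) (τ₁ / 4)), by positivity, ?_, ?_, ?_, ?_⟩
    all_goals
      have a1 := min_le_left (min (κ * ρ / 2) (μ / 4)) (min (τ₀ / 4) (τ₁ / 4))
      have a2 := min_le_right (min (κ * ρ / 2) (μ / 4)) (min (τ₀ / 4) (τ₁ / 4))
      have a3 := min_le_left (κ * ρ / 2) (μ / 4)
      have a4 := min_le_right (κ * ρ / 2) (μ / 4)
      have a5 := min_le_left (τ₀ / 4) (τ₁ / 4)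
      have a6 := min_le_right (τ₀ / 4) (τ₁ / 4)
      linarith
  refine ⟨θ s₀ T - θ 0 s₀ - Real.pi + 2 * Real.pi * K, 1 - 2 * K, by omega, ε, hε, ?_⟩
  intro x y hx hxy cx cy
  obtain ⟨⟨k, hk⟩, ⟨l, hl⟩⟩ :=
    Follows.exists_abs_sub_le hθ hg hinj hκ hκη hκ0 hh hρh hεκ hx hxy cx cy
  have hk1 := hk s₀ T hs₀.le (by linarith) le_rfl
  have hl1 := hl s₀ 0 le_rfl (by linarith) hT.le
  rw [add_zero] at hl1
  have re_close : ∀ z, Follows g T ε z → ∀ r ∈ Set.Icc 0 T,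
      |(g (z + r)).re - (g r).re| ≤ ε := by
    intro z hz r hr
    rw [← Complex.sub_re]
    exact (Complex.abs_re_le_norm _).trans (hz r hr)
  have key : ∀ u v, Follows g T ε u → Follows g T ε v → ∀ t ∈ Set.Icc 0 T,
      (g (u + s₀)).re ≤ (g (v + t)).re → |t - s₀| < h ∧ |θ 0 t - θ 0 s₀| < 1 / 10 ∧
      |θ t T - θ s₀ T| < 1 / 10 ∧
      |(g (v + t) - g u).arg - (g s₀ - g 0).arg| ≤ 1 / 10 ∧
      |(g (v + t) - g (u + T)).arg - (g s₀ - g T).arg| ≤ 1 / 10 := by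
    intro u v hu hv t ht huv
    have h1 := abs_le.1 (re_close u hu s₀ hms)
    have h2 := abs_le.1 (re_close v hv t ht)
    have h3 := hgap t ht (by linarith)
    obtain ⟨b1, b2, b3⟩ := hball (y := t) (by rw [Real.dist_eq]; linarith)
    have hr : ∀ r ∈ Set.Icc 0 T, ‖g (v + t) - g (u + r) - (g s₀ - g r)‖ ≤
        2 * ε + min τ₀ τ₁ / 2 := by
      intro r hr
      calc _ = ‖(g (v + t) - g t) - (g (u + r) - g r) + (g t - g s₀)‖ := by congr 1; ring
        _ ≤ ε + ε + min τ₀ τ₁ / 2 := (norm_add_le _ _).trans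
            (add_le_add ((norm_sub_le _ _).trans (add_le_add (hv t ht) (hu r hr))) b3.le)
        _ = _ := by ring
    have r0 := hr 0 hm0
    have r1 := hr T hmT
    rw [add_zero] at r0
    refine ⟨h3, b1, b2, harg₀ _ ?_, harg₁ _ ?_⟩
    · have := min_le_left τ₀ τ₁
      linarith
    · have := min_le_right τ₀ τ₁
      linarith
  have hne : ∀ s ∈ Set.Icc 0 T, ∀ t ∈ Set.Icc 0 T, g (y + t) - g (x + s) ≠ 0 := by
    intro s hs t ht h0
    have h1 : (0 : ℝ) ≤ x + s := by linarith [hs.1]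
    have h2 : x + s < y + t := by linarith [hs.2, ht.1]
    exact h2.ne' (hinj (Set.mem_Ici.2 (h1.trans h2.le)) (Set.mem_Ici.2 h1) (sub_eq_zero.1 h0))
  constructor
  · rintro ⟨t, ht, htx⟩
    obtain ⟨c1, c2, c3, c4, c5⟩ := key x y cx cy t ht (htx s₀ hms)
    obtain ⟨m, hm⟩ := exists_eq_arg_add (S := Set.Icc 0 T) isPreconnected_Icc
      (f := fun s => g (y + t) - g (x + s)) (φ := fun s => θ (x + s) (y + t))
      (by fun_prop) (hθ.comp (by fun_prop) (by fun_prop) fun s hs =>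
        ⟨by linarith [hs.1], by linarith [hs.2, ht.1]⟩)
      (fun s hs => mem_slitPlane_of_re_nonneg (hne s hs t ht) (by
        rw [Complex.sub_re]; linarith [htx s hs]))
      (fun s hs => hθ.coe_eq _ _ (by linarith [hs.1]) (by linarith [hs.2, ht.1]))
    have m0 := hm 0 hm0
    have m1 := hm T hmT
    have k0 := hk 0 t le_rfl (by linarith [(abs_lt.1 c1).1]) ht.2
    have l0 := hl T t ht.1 (by linarith [(abs_lt.1 c1).2]) le_rfl
    simp only [add_zero] at m0 k0
    have : k - l = K := by
      apply int_eq_of_abs_sub_lt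
      push_cast
      rw [abs_lt]
      simp only [abs_le, abs_lt] at c2 c3 c4 c5 k0 l0
      constructor <;> linarith [c2.1, c2.2, c3.1, c3.2, c4.1, c4.2, c5.1, c5.2]
    subst this
    push_cast at hK ⊢
    simp only [abs_le] at hk1 hl1 ⊢
    constructor <;> linarith [hk1.1, hk1.2, hl1.1, hl1.2]
  · rintro ⟨s, hs, hsy⟩
    obtain ⟨c1, c2, c3, c4, c5⟩ := key y x cy cx s hs (hsy s₀ hms)
    obtain ⟨m, hm⟩ := exists_eq_arg_add (S := Set.Icc 0 T) isPreconnected_Icc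
      (f := fun t => g (x + s) - g (y + t)) (φ := fun t => θ (x + s) (y + t) + Real.pi)
      (by fun_prop) ((hθ.comp (by fun_prop) (by fun_prop) fun t ht =>
        ⟨by linarith [hs.1], by linarith [hs.2, ht.1]⟩).add continuousOn_const)
      (fun t ht => mem_slitPlane_of_re_nonneg
        (by rw [← neg_sub]; exact neg_ne_zero.2 (hne s hs t ht)) (by
        rw [Complex.sub_re]; linarith [hsy t ht]))
      (fun t ht => hθ.coe_add_pi hinj (by linarith [hs.1]) (by linarith [hs.2, ht.1]))
    have m0 := hm 0 hm0
    have m1 := hm T hmT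
    have k0 := hk s T hs.1 (by linarith [(abs_lt.1 c1).2]) le_rfl
    have l0 := hl s 0 le_rfl (by linarith [(abs_lt.1 c1).1]) hs.2
    simp only [add_zero] at m0 l0
    have : k - l = 1 - K := by
      apply int_eq_of_abs_sub_lt
      push_cast
      rw [abs_lt]
      simp only [abs_le, abs_lt] at c2 c3 c4 c5 k0 l0
      constructor <;> linarith [c2.1, c2.2, c3.1, c3.2, c4.1, c4.2, c5.1, c5.2]
    obtain rfl : K = 1 - (k - l) := by omega
    push_cast at hK ⊢
    simp only [abs_le] at hk1 hl1 ⊢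
    constructor <;> linarith [hk1.1, hk1.2, hl1.1, hl1.2]

/-- The largest height `re g` reached during `[x, x + T]`. -/
noncomputable def peak (g : ℝ → ℂ) (T x : ℝ) : ℝ :=
  sSup ((fun r => (g (x + r)).re) '' Set.Icc 0 T)

theorem re_le_peak {g : ℝ → ℂ} (hg : Continuous g) {T : ℝ} (x : ℝ) {r : ℝ}
    (hr : r ∈ Set.Icc 0 T) : (g (x + r)).re ≤ peak g T x :=
  le_csSup (isCompact_Icc.image (by fun_prop)).bddAbove (Set.mem_image_of_mem _ hr)

theorem exists_re_eq_peak {g : ℝ → ℂ} (hg : Continuous g) {T : ℝ} (hT : 0 ≤ T) (x : ℝ) :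
    ∃ r ∈ Set.Icc 0 T, (g (x + r)).re = peak g T x := by
  have := (isCompact_Icc.image (f := fun r => (g (x + r)).re) (by fun_prop)).sSup_mem
    ((Set.nonempty_Icc.2 hT).image _)
  exact this

theorem exists_forall_re_le_of_peak_le {g : ℝ → ℂ} (hg : Continuous g) {T : ℝ} (hT : 0 ≤ T)
    {x y : ℝ} (h : peak g T x ≤ peak g T y) :
    ∃ t ∈ Set.Icc 0 T, ∀ s ∈ Set.Icc 0 T, (g (x + s)).re ≤ (g (y + t)).re := by
  obtain ⟨t, ht, hty⟩ := exists_re_eq_peak hg hT y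
  exact ⟨t, ht, fun s hs => hty ▸ (re_le_peak hg x hs).trans h⟩

theorem Follows.abs_peak_sub_le {g : ℝ → ℂ} (hg : Continuous g) {T : ℝ} (hT : 0 ≤ T)
    {ε y : ℝ} (h : Follows g T ε y) : |peak g T y - peak g T 0| ≤ ε := by
  have hre : ∀ r ∈ Set.Icc 0 T, |(g (y + r)).re - (g (0 + r)).re| ≤ ε := by
    intro r hr
    rw [← Complex.sub_re, zero_add]
    exact (Complex.abs_re_le_norm _).trans (h r hr)
  obtain ⟨t, ht, hty⟩ := exists_re_eq_peak hg hT y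
  obtain ⟨s, hs, hsy⟩ := exists_re_eq_peak hg hT 0
  have h1 := re_le_peak hg y hs
  have h2 := re_le_peak hg 0 ht
  have h3 := abs_le.1 (hre t ht)
  have h4 := abs_le.1 (hre s hs)
  rw [abs_le]
  constructor <;> linarith [h3.2, h4.1]

/-- The integer `N t` counts the turns of the direction from `g s₀` to `g t` relative to the
direction from the nearby point `g (b + s₀)`; it only changes when the curve passes `g s₀`. -/
theorem exists_relative_turns {g : ℝ → ℂ} {θ : ℝ → ℝ → ℝ} (hθ : IsAngleLift g θ)
    (hg : Continuous g) (hinj : Set.InjOn g (Set.Ici 0)) (hsh : Shadowing g) {T s₀ : ℝ}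
    (hs₀ : 0 < s₀) (hT : s₀ < T) {A : ℝ} {c : ℤ} {ε : ℝ} (hε : 0 < ε)
    (hdich : ∀ x y, 0 ≤ x → x + T < y → Follows g T ε x → Follows g T ε y →
      (peak g T x ≤ peak g T y → |θ (x + s₀) (y + T) - θ (x + s₀) y - A| ≤ 1 / 5) ∧
      (peak g T y ≤ peak g T x →
        |θ (x + s₀) (y + T) - θ (x + s₀) y - (A + 2 * Real.pi * c)| ≤ 1 / 5)) :
    ∃ h > 0, 3 * h ≤ s₀ ∧ 3 * h ≤ T - s₀ ∧ ∃ ρ₀ > 0, ∃ ε₂ > 0, ∃ δ > 0,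
      (∀ u v, 0 ≤ u → ‖g u - g s₀‖ ≤ ρ₀ → u + h ≤ v → v ≤ u + T → ρ₀ < ‖g v - g s₀‖) ∧
      (∀ y ≥ 0, ‖g y - g 0‖ < δ → ‖g (y + s₀) - g s₀‖ ≤ ρ₀ ∧ Follows g T ε y) ∧
      ∀ b ≥ 0, Follows g T ε₂ b → ∃ N : ℝ → ℤ, ∃ d : ℤ, (d = c ∨ d = -c) ∧
        (∀ t t', b + T ≤ t → t ≤ t' → (∀ v ∈ Set.Icc t t', ρ₀ < ‖g v - g s₀‖) → N t = N t') ∧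
        (∀ u ≥ b + 3 * T, ‖g u - g s₀‖ ≤ ρ₀ →
          N (u + T - s₀) = N (u - s₀) ∨ N (u + T - s₀) = N (u - s₀) + d) ∧
        (∀ y ≥ b + 3 * T, ‖g y - g 0‖ < δ →
          (peak g T b < peak g T y ∧ peak g T y < peak g T 0 ∨
            peak g T 0 < peak g T y ∧ peak g T y < peak g T b) → N (y + T) = N y + d) ∧
        ∃ δ' > 0, ∃ C : ℝ, ∀ y ≥ b + 3 * T, ‖g y - g 0‖ < δ' → |(N y : ℝ)| ≤ C := by
  have hpi := Real.pi_gt_three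
  obtain ⟨κ, hκ0, hκ, hκη⟩ := exists_abs_arg_le (η := 1 / 10) (by norm_num)
  have hT0 : 0 < T := hs₀.trans hT
  have hm0 : (0 : ℝ) ∈ Set.Icc 0 T := ⟨le_rfl, hT0.le⟩
  have hms : s₀ ∈ Set.Icc 0 T := ⟨hs₀.le, hT.le⟩
  have shadow : ∀ ε' > 0, ∃ δ > 0, ∀ y ≥ 0, ‖g y - g 0‖ < δ → Follows g T ε' y := by
    intro ε' hε'
    obtain ⟨δ, hδ, h⟩ := hsh T hT0 ε' hε'
    refine ⟨δ, hδ, fun y hy hyδ r hr => ?_⟩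
    have := h 0 hm0 y hy hyδ r hr
    rw [zero_add] at this
    exact this.le
  obtain ⟨δ₁, hδ₁, hfol⟩ := shadow ε hε
  obtain ⟨h, hh, hosc, hhs, hhT⟩ : ∃ h > 0, (∀ s ∈ Set.Icc 0 h, ‖g s - g 0‖ < δ₁ / 2) ∧
      3 * h ≤ s₀ ∧ 3 * h ≤ T - s₀ := by
    obtain ⟨h₁, hh₁, hosc⟩ := Metric.continuousAt_iff.1 (hg.continuousAt (x := 0)) (δ₁ / 2)
      (by positivity)
    have : 0 < T - s₀ := sub_pos.2 hT
    refine ⟨min (h₁ / 2) (min (s₀ / 3) ((T - s₀) / 3)), by positivity, ?_, ?_, ?_⟩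
    · intro s hs
      rw [← dist_eq_norm]
      refine hosc ?_
      rw [Real.dist_eq, sub_zero, abs_of_nonneg hs.1]
      exact (hs.2.trans (min_le_left _ _)).trans_lt (by linarith)
    · have := (min_le_right (h₁ / 2) _).trans (min_le_left (s₀ / 3) ((T - s₀) / 3))
      linarith
    · have := (min_le_right (h₁ / 2) _).trans (min_le_right (s₀ / 3) ((T - s₀) / 3))
      linarith
  obtain ⟨ρ, hρ, hsep⟩ := exists_forall_le_norm_sub hg hinj (2 * T) hh
  obtain ⟨δ₂, hδ₂, hsh₂⟩ := hsh T hT0 (ρ / 3) (by positivity)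
  obtain ⟨ρ₀, hρ₀, hρ₀δ, hρ₀ρ⟩ : ∃ ρ₀ > 0, ρ₀ < δ₂ ∧ ρ₀ ≤ ρ / 3 :=
    ⟨min (δ₂ / 2) (ρ / 3), by positivity, (min_le_left _ _).trans_lt (by linarith),
      min_le_right _ _⟩
  obtain ⟨ρ₂, hρ₂, hρ₂δ, hρ₂ρ, hρ₂δ₁⟩ : ∃ ρ₂ > 0, ρ₂ ≤ δ₂ ∧ ρ₂ ≤ ρ / 3 ∧ ρ₂ ≤ δ₁ / 2 :=
    ⟨min δ₂ (min (ρ / 3) (δ₁ / 2)), by positivity, min_le_left _ _,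
      (min_le_right _ _).trans (min_le_left _ _), (min_le_right _ _).trans (min_le_right _ _)⟩
  obtain ⟨ε₂, hε₂, hε₂ε, hε₂ρ₀, hε₂ρ₂⟩ : ∃ ε₂ > 0, ε₂ ≤ ε ∧ 2 * ε₂ ≤ κ * ρ₀ ∧
      2 * ε₂ ≤ κ * ρ₂ := by
    refine ⟨min ε (min (κ * ρ₀ / 2) (κ * ρ₂ / 2)), by positivity, min_le_left _ _, ?_, ?_⟩
    · have := (min_le_right ε _).trans (min_le_left (κ * ρ₀ / 2) (κ * ρ₂ / 2))
      linarith
    · have := (min_le_right ε _).trans (min_le_right (κ * ρ₀ / 2) (κ * ρ₂ / 2))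
      linarith
  obtain ⟨δ₃, hδ₃, hfol₀⟩ := shadow ρ₀ hρ₀
  have hcluster : ∀ u v, 0 ≤ u → ‖g u - g s₀‖ ≤ ρ₀ → u + h ≤ v → v ≤ u + T →
      ρ₀ < ‖g v - g s₀‖ := by
    intro u v hu hnu huv hvu
    by_contra! hnv
    have h1 := hsh₂ s₀ hms u hu (hnu.trans_lt hρ₀δ) (v - u) ⟨by linarith, by linarith⟩
    rw [add_sub_cancel] at h1
    have h2 := hsep (s₀ + (v - u)) ⟨by linarith, by linarith⟩ s₀ ⟨by linarith, by linarith⟩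
      (by rw [add_sub_cancel_left]; exact le_trans (by linarith) (le_abs_self _))
    have h3 := norm_sub_le_norm_sub_add_norm_sub (g (s₀ + (v - u))) (g v) (g s₀)
    rw [norm_sub_rev] at h1
    linarith
  have havoid : ∀ y ≥ 0, ‖g (y + s₀) - g s₀‖ ≤ ρ₀ →
      (∀ t ∈ Set.Icc 0 h, δ₁ ≤ ‖g (y + t) - g 0‖) →
      ∀ s ∈ Set.Icc 0 s₀, ∀ t ∈ Set.Icc 0 T, (t = 0 ∨ t = T ∨ s = 0) →
        ρ₂ ≤ ‖g (y + t) - g s‖ := by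
    intro y hy hny hδy s hs t ht hst
    by_contra! hlt
    have hts : h ≤ |s - t| := by
      by_contra! hts
      have hts := abs_lt.1 hts
      rcases hst with rfl | rfl | rfl
      · have h1 := hosc s ⟨hs.1, by linarith [hts.2]⟩
        have h2 := hδy 0 ⟨le_rfl, hh.le⟩
        have h3 := norm_sub_le_norm_sub_add_norm_sub (g (y + 0)) (g s) (g 0)
        linarith
      · linarith [hs.2, hts.1]
      · have h2 := hδy t ⟨ht.1, by linarith [hts.1]⟩
        linarith
    rcases le_total t s₀ with h1 | h1
    · have h2 := hsh₂ s ⟨hs.1, hs.2.trans hT.le⟩ (y + t) (by linarith [ht.1])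
        (hlt.trans_le hρ₂δ) (s₀ - t) ⟨by linarith, by linarith [ht.1]⟩
      rw [show y + t + (s₀ - t) = y + s₀ by ring] at h2
      have h3 := hsep (s + (s₀ - t)) ⟨by linarith [hs.1], by linarith [hs.2, ht.1]⟩ s₀
        ⟨by linarith, by linarith⟩ (by rwa [show s + (s₀ - t) - s₀ = s - t by ring])
      have h4 := norm_sub_le_norm_sub_add_norm_sub (g (s + (s₀ - t))) (g (y + s₀)) (g s₀)
      rw [norm_sub_rev] at h2
      linarith
    · have h2 := hsh₂ s₀ hms (y + s₀) (by linarith) (hny.trans_lt hρ₀δ) (t - s₀)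
        ⟨by linarith, by linarith [ht.2]⟩
      rw [show y + s₀ + (t - s₀) = y + t by ring, add_sub_cancel] at h2
      have h3 := hsep s ⟨hs.1, by linarith [hs.2]⟩ t ⟨ht.1, by linarith [ht.2]⟩ hts
      have h4 := norm_sub_le_norm_sub_add_norm_sub (g s) (g (y + t)) (g t)
      rw [norm_sub_rev] at hlt
      linarith
  refine ⟨h, hh, hhs, hhT, ρ₀, hρ₀, ε₂, hε₂, min δ₁ δ₃, by positivity, hcluster, ?_, ?_⟩
  · intro y hy hyδ
    exact ⟨hfol₀ y hy (hyδ.trans_le (min_le_right _ _)) s₀ hms,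
      hfol y hy (hyδ.trans_le (min_le_left _ _))⟩
  intro b hb hbf
  have hbε : Follows g T ε b := fun r hr => (hbf r hr).trans hε₂ε
  have h0ε : Follows g T ε 0 := fun r _ => by rw [zero_add, sub_self, norm_zero]; exact hε.le
  have compare : ∀ {X : Type} [TopologicalSpace X] (S : Set X) (_ : IsPreconnected S)
      (s t : X → ℝ) (_ : Continuous s) (_ : Continuous t) (ρ' : ℝ) (_ : 2 * ε₂ ≤ κ * ρ')
      (_ : ∀ σ ∈ S, s σ ∈ Set.Icc 0 T ∧ b + s σ < t σ ∧ ρ' ≤ ‖g (t σ) - g (s σ)‖),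
      ∃ k : ℤ, ∀ σ ∈ S, |θ (s σ) (t σ) - θ (b + s σ) (t σ) - 2 * Real.pi * k| ≤ 1 / 10 := by
    intro X _ S hS s t hs ht ρ' hρ' hst
    refine hθ.exists_abs_sub_le hg hinj hκ hκη hS (by fun_prop) (by fun_prop) (by fun_prop)
      (by fun_prop) (fun σ hσ => ?_) (fun σ hσ => ?_) (fun σ hσ => ?_)
    all_goals obtain ⟨⟨h1, h2⟩, h3, h4⟩ := hst σ hσ
    · exact ⟨h1, by linarith⟩
    · exact ⟨by linarith, h3⟩
    · have h5 := hbf (s σ) ⟨h1, h2⟩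
      have h6 := norm_sub_le_norm_sub_add_norm_sub (g (t σ)) (g (b + s σ)) (g (s σ))
      rw [sub_sub_sub_cancel_left]
      calc _ ≤ ε₂ := h5
        _ ≤ κ * (ρ' - ε₂) := by nlinarith
        _ ≤ _ := by gcongr; linarith
  set F : ℝ → ℝ := fun t => θ s₀ t - θ (b + s₀) t with hF
  let N : ℝ → ℤ := fun t => round (F t / (2 * Real.pi))
  have hN : ∀ (t : ℝ) (k : ℤ), |F t - 2 * Real.pi * k| ≤ 1 / 10 →
      |F t - 2 * Real.pi * N t| ≤ 1 / 10 := by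
    intro t k hk
    refine le_trans ?_ hk
    have h1 := round_le (F t / (2 * Real.pi)) k
    have h2 : ∀ r : ℝ, F t - 2 * Real.pi * r = 2 * Real.pi * (F t / (2 * Real.pi) - r) := by
      intro r
      field_simp
    rw [h2, h2, abs_mul (2 * Real.pi), abs_mul (2 * Real.pi)]
    exact mul_le_mul_of_nonneg_left h1 (abs_nonneg _)
  have hstay : ∀ t t', b + T ≤ t → t ≤ t' → (∀ v ∈ Set.Icc t t', ρ₀ < ‖g v - g s₀‖) →
      N t = N t' ∧ |F t - 2 * Real.pi * N t| ≤ 1 / 10 := by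
    intro t t' ht htt' hfar
    obtain ⟨k, hk⟩ := compare (Set.Icc t t') isPreconnected_Icc (fun _ => s₀) (fun v => v)
      continuous_const continuous_id ρ₀ hε₂ρ₀
      (fun v hv => ⟨hms, by linarith [hv.1], (hfar v hv).le⟩)
    have k1 := hk t ⟨le_rfl, htt'⟩
    have k2 := hk t' ⟨htt', le_rfl⟩
    have n1 := hN t k k1
    have n2 := hN t' k k2
    refine ⟨?_, n1⟩
    trans k
    all_goals
      apply int_eq_of_abs_sub_lt
      simp only [hF, abs_le, abs_lt] at *
      constructor <;> linarith [k1.1, k1.2, k2.1, k2.2, n1.1, n1.2, n2.1, n2.2]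
  have hfar : ∀ t, b + T ≤ t → ρ₀ < ‖g t - g s₀‖ → |F t - 2 * Real.pi * N t| ≤ 1 / 10 := by
    intro t ht hft
    exact (hstay t t ht le_rfl fun v hv => by rwa [le_antisymm hv.2 hv.1]).2
  have hdF : ∀ y, F (y + T) - F y =
      (θ (0 + s₀) (y + T) - θ (0 + s₀) y) - (θ (b + s₀) (y + T) - θ (b + s₀) y) := by
    intro y
    simp only [hF, zero_add]
    ring
  have hjump : ∀ y, b + T < y → ρ₀ < ‖g y - g s₀‖ → ρ₀ < ‖g (y + T) - g s₀‖ →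
      ∀ m : ℤ, |F (y + T) - F y - 2 * Real.pi * m| ≤ 2 / 5 → N (y + T) = N y + m := by
    intro y hy f1 f2 m hm
    have n1 := hfar y hy.le f1
    have n2 := hfar (y + T) (by linarith) f2
    apply int_eq_of_abs_sub_lt
    push_cast
    simp only [abs_le, abs_lt] at *
    constructor <;> linarith [hm.1, hm.2, n1.1, n1.2, n2.1, n2.2]
  obtain ⟨d, hd, hdb⟩ : ∃ d : ℤ, (d = c ∨ d = -c) ∧ ((peak g T b ≤ peak g T 0 ∧ d = c) ∨
      (peak g T 0 < peak g T b ∧ d = -c)) := by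
    rcases le_or_gt (peak g T b) (peak g T 0) with h1 | h1
    · exact ⟨c, Or.inl rfl, Or.inl ⟨h1, rfl⟩⟩
    · exact ⟨-c, Or.inr rfl, Or.inr ⟨h1, rfl⟩⟩
  have hsame : ∀ B y, |θ (0 + s₀) (y + T) - θ (0 + s₀) y - B| ≤ 1 / 5 →
      |θ (b + s₀) (y + T) - θ (b + s₀) y - B| ≤ 1 / 5 →
      |F (y + T) - F y - 2 * Real.pi * (0 : ℤ)| ≤ 2 / 5 := by
    intro B y h1 h2
    rw [hdF]
    push_cast
    simp only [abs_le] at *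
    constructor <;> linarith [h1.1, h1.2, h2.1, h2.2]
  have hbetween : ∀ y, b + T < y → Follows g T ε y → (peak g T b ≤ peak g T y ∧
      peak g T y ≤ peak g T 0 ∧ d = c ∨ peak g T 0 ≤ peak g T y ∧ peak g T y ≤ peak g T b ∧
      d = -c) → |F (y + T) - F y - 2 * Real.pi * d| ≤ 2 / 5 := by
    intro y hy hyf hc
    obtain ⟨p1, p2⟩ := hdich 0 y le_rfl (by linarith) h0ε hyf
    obtain ⟨q1, q2⟩ := hdich b y hb (by linarith) hbε hyf
    rw [hdF]
    rcases hc with ⟨c1, c2, rfl⟩ | ⟨c1, c2, rfl⟩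
    · have p2 := p2 c2
      have q1 := q1 c1
      simp only [abs_le] at *
      constructor <;> linarith [p2.1, p2.2, q1.1, q1.2]
    · have p1 := p1 c1
      have q2 := q2 c2
      push_cast
      simp only [abs_le] at *
      constructor <;> linarith [p1.1, p1.2, q2.1, q2.2]
  have hstrand : ∀ y, b + T < y → Follows g T ε y → ρ₀ < ‖g y - g s₀‖ →
      ρ₀ < ‖g (y + T) - g s₀‖ → N (y + T) = N y ∨ N (y + T) = N y + d := by
    intro y hy hyf f1 f2
    obtain ⟨p1, p2⟩ := hdich 0 y le_rfl (by linarith) h0ε hyf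
    obtain ⟨q1, q2⟩ := hdich b y hb (by linarith) hbε hyf
    have hzero : ∀ B, |θ (0 + s₀) (y + T) - θ (0 + s₀) y - B| ≤ 1 / 5 →
        |θ (b + s₀) (y + T) - θ (b + s₀) y - B| ≤ 1 / 5 → N (y + T) = N y := by
      intro B h1 h2
      rw [hjump y hy f1 f2 0 (hsame B y h1 h2), add_zero]
    rcases le_total (peak g T 0) (peak g T y) with m1 | m1 <;>
      rcases le_total (peak g T b) (peak g T y) with m2 | m2
    · exact Or.inl (hzero _ (p1 m1) (q1 m2))
    · rcases hdb with ⟨hb0, -⟩ | ⟨-, hdc⟩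
      · exact Or.inl (hzero _ (p2 (m2.trans hb0)) (q2 m2))
      · exact Or.inr (hjump y hy f1 f2 d (hbetween y hy hyf (Or.inr ⟨m1, m2, hdc⟩)))
    · rcases hdb with ⟨-, hdc⟩ | ⟨hb0, -⟩
      · exact Or.inr (hjump y hy f1 f2 d (hbetween y hy hyf (Or.inl ⟨m2, m1, hdc⟩)))
      · exact absurd (hb0.trans_le m2) m1.not_gt
    · exact Or.inl (hzero _ (p2 m1) (q2 m2))
  have hends : ∀ u, 0 ≤ u - s₀ → ‖g u - g s₀‖ ≤ ρ₀ → ∀ v, u - s₀ ≤ v → v ≤ u + T →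
      (v ≤ u - h ∨ u + h ≤ v) → ρ₀ < ‖g v - g s₀‖ := by
    intro u hu hnu v hv1 hv2 hv
    rcases hv with hv | hv
    · by_contra! hnv
      exact hnu.not_gt (hcluster v u (by linarith) hnv (by linarith) (by linarith))
    · exact hcluster u v (by linarith) hnu hv hv2
  refine ⟨N, d, hd, fun t t' h1 h2 h3 => (hstay t t' h1 h2 h3).1, ?_, ?_, ?_⟩
  · intro u hu hnu
    obtain ⟨y, rfl⟩ : ∃ y, u = y + s₀ := ⟨u - s₀, by ring⟩
    rw [show y + s₀ + T - s₀ = y + T by ring, add_sub_cancel_right]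
    have hend := hends (y + s₀) (by linarith) hnu
    have f1 := hend y (by linarith) (by linarith) (Or.inl (by linarith))
    have f2 := hend (y + T) (by linarith) (by linarith) (Or.inr (by linarith))
    by_cases hvis : ∃ t ∈ Set.Icc 0 h, ‖g (y + t) - g 0‖ < δ₁
    · obtain ⟨t, ht, htδ⟩ := hvis
      have e1 := (hstay y (y + t) (by linarith) (by linarith [ht.1]) fun v hv =>
        hend v (by linarith [hv.1]) (by linarith [hv.2, ht.2])
          (Or.inl (by linarith [hv.2, ht.2]))).1
      have e2 := (hstay (y + T) (y + t + T) (by linarith) (by linarith [ht.1]) fun v hv =>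
        hend v (by linarith [hv.1]) (by linarith [hv.2, ht.2])
          (Or.inr (by linarith [hv.1, ht.1]))).1
      rw [e1, e2]
      exact hstrand (y + t) (by linarith [ht.1]) (hfol _ (by linarith [ht.1]) htδ)
        (hend _ (by linarith [ht.1]) (by linarith [ht.2]) (Or.inl (by linarith [ht.2])))
        (hend _ (by linarith [ht.1]) (by linarith [ht.2]) (Or.inr (by linarith [ht.1])))
    · push Not at hvis
      left
      have hav := havoid y (by linarith) hnu hvis
      obtain ⟨k, hk⟩ := compare (Set.Icc 0 (2 * s₀ + T)) isPreconnected_Icc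
        (fun σ => max 0 (max (s₀ - σ) (σ - s₀ - T))) (fun σ => y + max 0 (min (σ - s₀) T))
        (by fun_prop) (by fun_prop) ρ₂ hε₂ρ₂ (by
          intro σ hσ
          have hs : max 0 (max (s₀ - σ) (σ - s₀ - T)) ∈ Set.Icc 0 s₀ :=
            ⟨le_max_left _ _, max_le hs₀.le (max_le (by linarith [hσ.1]) (by linarith [hσ.2]))⟩
          have ht : max 0 (min (σ - s₀) T) ∈ Set.Icc 0 T :=
            ⟨le_max_left _ _, max_le hT0.le (min_le_right _ _)⟩
          refine ⟨⟨hs.1, hs.2.trans hT.le⟩, by linarith [hs.2, ht.1], hav _ hs _ ht ?_⟩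
          rcases le_total σ s₀ with h1 | h1
          · exact Or.inl (max_eq_left ((min_le_left _ _).trans (by linarith)))
          · rcases le_total σ (s₀ + T) with h2 | h2
            · exact Or.inr (Or.inr (max_eq_left (max_le (by linarith) (by linarith))))
            · right; left
              rw [min_eq_right (by linarith), max_eq_right hT0.le])
      have k1 := hk 0 ⟨le_rfl, by linarith⟩
      have k2 := hk (2 * s₀ + T) ⟨by linarith, le_rfl⟩
      simp only [sub_zero, zero_sub] at k1
      rw [max_eq_left (show -s₀ - T ≤ s₀ by linarith), max_eq_right hs₀.le,
        min_eq_left (by linarith), max_eq_left (show -s₀ ≤ 0 by linarith), add_zero] at k1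
      rw [max_eq_right (show s₀ - (2 * s₀ + T) ≤ 2 * s₀ + T - s₀ - T by linarith),
        max_eq_right (by linarith), min_eq_right (by linarith), max_eq_right hT0.le,
        show 2 * s₀ + T - s₀ - T = s₀ by ring] at k2
      rw [hjump y (by linarith) f1 f2 0 ?_, add_zero]
      push_cast
      simp only [hF, abs_le] at *
      constructor <;> linarith [k1.1, k1.2, k2.1, k2.2]
  · intro y hy hyδ hbt
    have hnu : ‖g (y + s₀) - g s₀‖ ≤ ρ₀ :=
      hfol₀ y (by linarith) (hyδ.trans_le (min_le_right _ _)) s₀ hms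
    have hend := hends (y + s₀) (by linarith) hnu
    refine hjump y (by linarith) (hend y (by linarith) (by linarith) (Or.inl (by linarith)))
      (hend (y + T) (by linarith) (by linarith) (Or.inr (by linarith))) d
      (hbetween y (by linarith) (hfol y (by linarith) (hyδ.trans_le (min_le_left _ _))) ?_)
    rcases hbt with ⟨h1, h2⟩ | ⟨h1, h2⟩ <;> rcases hdb with ⟨h3, h4⟩ | ⟨h3, h4⟩
    · exact Or.inl ⟨h1.le, h2.le, h4⟩
    · linarith
    · linarith
    · exact Or.inr ⟨h1.le, h2.le, h4⟩
  · obtain ⟨ρ₃, hρ₃, hsep₃⟩ := exists_forall_le_norm_sub hg hinj (b + s₀) hs₀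
    refine ⟨κ * ρ₃, by positivity,
      |θ 0 s₀ - θ 0 (b + s₀)| / (2 * Real.pi) + 2, fun y hy hyδ => ?_⟩
    obtain ⟨k, hk⟩ := hθ.exists_abs_sub_add_pi_le hg hinj hκ hκη
      (S := Set.Icc s₀ (b + s₀)) isPreconnected_Icc (a := fun s => s) (b := fun _ => y)
      (a' := fun _ => 0) (b' := fun s => s) (by fun_prop) (by fun_prop) (by fun_prop)
      (by fun_prop) (fun s hs => ⟨by linarith [hs.1], by linarith [hs.2]⟩)
      (fun s hs => ⟨le_rfl, by linarith [hs.1]⟩) (fun s hs => by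
        rw [sub_sub_sub_cancel_right]
        refine hyδ.le.trans ?_
        gcongr
        refine hsep₃ 0 ⟨le_rfl, by linarith⟩ s ⟨by linarith [hs.1], hs.2⟩ ?_
        rw [zero_sub, abs_neg]
        exact hs.1.trans (le_abs_self _))
    have k1 := hk s₀ ⟨le_rfl, by linarith⟩
    have k2 := hk (b + s₀) ⟨by linarith, le_rfl⟩
    have h1 : |F y| ≤ |θ 0 s₀ - θ 0 (b + s₀)| + 1 / 5 := by
      have h2 := neg_abs_le (θ 0 s₀ - θ 0 (b + s₀))
      have h3 := le_abs_self (θ 0 s₀ - θ 0 (b + s₀))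
      rw [abs_le] at k1 k2 ⊢
      simp only [hF]
      constructor <;> linarith [k1.1, k1.2, k2.1, k2.2]
    have h2 := abs_sub_round (F y / (2 * Real.pi))
    have h3 : |F y / (2 * Real.pi)| ≤ |θ 0 s₀ - θ 0 (b + s₀)| / (2 * Real.pi) + 1 := by
      rw [abs_div, abs_of_pos Real.two_pi_pos]
      calc _ ≤ (|θ 0 s₀ - θ 0 (b + s₀)| + 1 / 5) / (2 * Real.pi) := by gcongr
        _ = |θ 0 s₀ - θ 0 (b + s₀)| / (2 * Real.pi) + 1 / 5 / (2 * Real.pi) := add_div _ _ _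
        _ ≤ _ := by
          gcongr
          rw [div_le_one (by positivity)]
          linarith
    have h4 := abs_sub_abs_le_abs_sub (N y : ℝ) (F y / (2 * Real.pi))
    rw [abs_sub_comm] at h4
    simp only [N] at *
    linarith

theorem mul_turns_le_mul_turns {near : Set ℝ} (hcl : IsClosed near) {h T s₀ t₀ : ℝ} {N : ℝ → ℤ}
    {d : ℤ} (hh : 0 < h) (hs₀ : 3 * h ≤ s₀) (hT : 3 * h ≤ T - s₀) (ht₀ : 2 * T ≤ t₀)
    (hcluster : ∀ u v, 0 ≤ u → u ∈ near → u + h ≤ v → v ≤ u + T → v ∉ near)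
    (hstay : ∀ t t', t₀ - 2 * T ≤ t → t ≤ t' → (∀ v ∈ Set.Icc t t', v ∉ near) → N t = N t')
    (hjump : ∀ u ≥ t₀, u ∈ near →
      N (u + T - s₀) = N (u - s₀) ∨ N (u + T - s₀) = N (u - s₀) + d) (n : ℕ) :
    ∀ t t', t₀ ≤ t → t ≤ t' → t' - t ≤ n * h → (∀ v, |v - t| ≤ h → v ∉ near) →
      (∀ v, |v - t'| ≤ h → v ∉ near) → d * N t ≤ d * N t' := by
  induction n with
  | zero =>
    intro t t' _ h2 h3 _ _
    have : t = t' := by push_cast at h3; linarith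
    rw [this]
  | succ n ih =>
    intro t t' h1 h2 h3 h4 h5
    by_cases hnear : ∀ v ∈ Set.Icc t t', v ∉ near
    · rw [hstay t t' (by linarith) h2 hnear]
    push Not at hnear
    obtain ⟨w, hw, hwn⟩ := hnear
    obtain ⟨u, ⟨hu, hun⟩, hleast⟩ :=
      (isCompact_Icc.inter_right hcl).exists_isLeast ⟨w, hw, hwn⟩
    have hbefore : ∀ v, t ≤ v → v < u → v ∉ near := fun v hv1 hv2 hv =>
      hv2.not_ge (hleast ⟨⟨hv1, hv2.le.trans hu.2⟩, hv⟩)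
    have htu : t + h < u := by
      by_contra! hlt
      exact h4 u (by rw [abs_of_nonneg (by linarith [hu.1])]; linarith) hun
    have hut' : u < t' - h := by
      by_contra! hlt
      exact h5 u (by rw [abs_sub_comm, abs_of_nonneg (by linarith [hu.2])]; linarith) hun
    have hleft : N t = N (u - s₀) := by
      rcases le_total t (u - s₀) with hle | hle
      · exact hstay _ _ (by linarith) hle fun v hv => hbefore v hv.1 (by linarith [hv.2])
      · refine (hstay _ _ (by linarith) hle fun v hv hvn => ?_).symm
        exact hcluster v u (by linarith [hv.1]) hvn (by linarith [hv.2]) (by linarith [hv.1]) hun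
    have hafter : ∀ v, u + h ≤ v → v ≤ u + T → v ∉ near := fun v hv1 hv2 =>
      hcluster u v (by linarith) hun hv1 hv2
    have hstep : d * N t ≤ d * N (u + T - s₀) := by
      rw [hleft]
      rcases hjump u (by linarith) hun with hj | hj <;> rw [hj]
      nlinarith [mul_self_nonneg d]
    refine hstep.trans ?_
    rcases le_total t' (u + T - s₀) with hle | hle
    · rw [← hstay t' (u + T - s₀) (by linarith) hle fun v hv =>
        hafter v (by linarith [hv.1]) (by linarith [hv.2])]
    · rw [← hstay (u + 2 * h) (u + T - s₀) (by linarith) (by linarith) fun v hv =>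
        hafter v (by linarith [hv.1]) (by linarith [hv.2])]
      refine ih _ _ (by linarith) (by linarith) ?_ (fun v hv => ?_) h5
      · push_cast at h3
        linarith
      · have := abs_le.1 hv
        exact hafter v (by linarith) (by linarith)

theorem not_recurrent_of_isolated_peak {g : ℝ → ℂ} (hg : Continuous g)
    (hinj : Set.InjOn g (Set.Ici 0)) (hsh : Shadowing g) {T s₀ : ℝ} (hs₀ : 0 < s₀) (hT : s₀ < T)
    (hmax : ∀ s ∈ Set.Icc 0 T, s ≠ s₀ → (g s).re < (g s₀).re) :
    ¬ ∀ ε > 0, ∀ R, ∃ t ≥ R, ‖g t - g 0‖ < ε := by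
  intro hrec
  have hpi := Real.pi_gt_three
  have hT0 : 0 < T := hs₀.trans hT
  have hm0 : (0 : ℝ) ∈ Set.Icc 0 T := ⟨le_rfl, hT0.le⟩
  obtain ⟨θ, hθ⟩ := exists_isAngleLift hg hinj
  obtain ⟨A, c, hc, ε, hε, hdich⟩ := exists_winding_dichotomy hθ hg hinj hs₀ hT hmax
  replace hdich : ∀ x y, 0 ≤ x → x + T < y → Follows g T ε x → Follows g T ε y →
      (peak g T x ≤ peak g T y → |θ (x + s₀) (y + T) - θ (x + s₀) y - A| ≤ 1 / 5) ∧
      (peak g T y ≤ peak g T x →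
        |θ (x + s₀) (y + T) - θ (x + s₀) y - (A + 2 * Real.pi * c)| ≤ 1 / 5) := by
    intro x y hx hxy hxf hyf
    exact (hdich x y hx hxy hxf hyf).imp
      (fun h1 h2 => h1 (exists_forall_re_le_of_peak_le hg hT0.le h2))
      (fun h1 h2 => h1 (exists_forall_re_le_of_peak_le hg hT0.le h2))
  obtain ⟨h, hh, hhs, hhT, ρ₀, hρ₀, ε₂, hε₂, δ, hδ, hcluster, hvisit, hturns⟩ :=
    exists_relative_turns hθ hg hinj hsh hs₀ hT hε hdich
  have shadow : ∀ ε' > 0, ∃ δ > 0, ∀ y ≥ 0, ‖g y - g 0‖ < δ → Follows g T ε' y := by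
    intro ε' hε'
    obtain ⟨δ, hδ, h⟩ := hsh T hT0 ε' hε'
    refine ⟨δ, hδ, fun y hy hyδ r hr => ?_⟩
    have := h 0 hm0 y hy hyδ r hr
    rw [zero_add] at this
    exact this.le
  have hpeak : ∀ y > T, ‖g y - g 0‖ < δ → peak g T y ≠ peak g T 0 := by
    intro y hy hyδ he
    have h0 : Follows g T ε 0 := fun r _ => by rw [zero_add, sub_self, norm_zero]; exact hε.le
    obtain ⟨h1, h2⟩ := hdich 0 y le_rfl (by linarith) h0 (hvisit y (by linarith) hyδ).2
    have h1 := abs_le.1 (h1 he.ge)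
    have h2 := abs_le.1 (h2 he.le)
    refine hc (int_eq_of_abs_sub_lt ?_)
    rw [abs_lt]
    push_cast
    constructor <;> linarith [h1.1, h1.2, h2.1, h2.2]
  obtain ⟨σ, hσ, hside⟩ : ∃ σ : ℝ, (σ = 1 ∨ σ = -1) ∧ ∀ δ' > 0, ∀ R, ∃ y ≥ R, ‖g y - g 0‖ < δ' ∧
      0 < σ * (peak g T 0 - peak g T y) := by
    by_cases hlow : ∀ δ' > 0, ∀ R, ∃ y ≥ R, ‖g y - g 0‖ < δ' ∧ peak g T y < peak g T 0
    · refine ⟨1, Or.inl rfl, fun δ' hδ' R => ?_⟩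
      obtain ⟨y, h1, h2, h3⟩ := hlow δ' hδ' R
      exact ⟨y, h1, h2, by linarith⟩
    · push Not at hlow
      obtain ⟨δ', hδ', R', hlow⟩ := hlow
      refine ⟨-1, Or.inr rfl, fun δ'' hδ'' R => ?_⟩
      obtain ⟨y, h1, h2⟩ := hrec (min δ (min δ' δ'')) (by positivity) (max (T + 1) (max R R'))
      have h3 := hlow y ((le_max_right _ _).trans ((le_max_right _ _).trans h1))
        (h2.trans_le ((min_le_right _ _).trans (min_le_left _ _)))
      have h4 := hpeak y (by linarith [(le_max_left _ _).trans h1])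
        (h2.trans_le (min_le_left _ _))
      refine ⟨y, (le_max_left _ _).trans ((le_max_right _ _).trans h1),
        h2.trans_le ((min_le_right _ _).trans (min_le_right _ _)), ?_⟩
      have := lt_of_le_of_ne h3 h4.symm
      linarith
  obtain ⟨δb, hδb, hfolb⟩ := shadow ε₂ hε₂
  obtain ⟨b, hb, hbδ, hbσ⟩ := hside δb hδb 0
  obtain ⟨N, d, hd, hstay, hjump, hadd, δ', hδ', C, hbdd⟩ := hturns b hb (hfolb b hb hbδ)
  have hd0 : d ≠ 0 := by
    rcases hd with rfl | rfl
    · exact hc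
    · exact neg_ne_zero.2 hc
  obtain ⟨δp, hδp, hfolp⟩ := shadow (σ * (peak g T 0 - peak g T b) / 2) (by positivity)
  set δv := min δ (min δ' δp) with hδv
  have hδv0 : 0 < δv := by positivity
  have hmono : ∀ y y', b + 3 * T ≤ y → y ≤ y' → (∀ v, |v - y| ≤ h → ρ₀ < ‖g v - g s₀‖) →
      (∀ v, |v - y'| ≤ h → ρ₀ < ‖g v - g s₀‖) → d * N y ≤ d * N y' := by
    intro y y' h1 h2 h3 h4
    obtain ⟨n, hn⟩ := exists_nat_ge ((y' - y) / h)
    exact mul_turns_le_mul_turns (near := {u | ‖g u - g s₀‖ ≤ ρ₀}) (t₀ := b + 3 * T)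
      (isClosed_le (by fun_prop) continuous_const) hh hhs hhT (by linarith)
      (fun u v u1 u2 u3 u4 => (hcluster u v u1 u2 u3 u4).not_ge)
      (fun t t' t1 t2 t3 => hstay t t' (by linarith) t2 fun v hv => not_le.1 (t3 v hv))
      (fun u u1 u2 => hjump u u1 u2) n y y' h1 h2 ((div_le_iff₀ hh).1 hn)
      (fun v hv => (h3 v hv).not_ge) (fun v hv => (h4 v hv).not_ge)
  have hgood : ∀ y ≥ b + 3 * T, ‖g y - g 0‖ < δv →
      (∀ v, |v - y| ≤ h → ρ₀ < ‖g v - g s₀‖) ∧ ∀ v, |v - (y + T)| ≤ h → ρ₀ < ‖g v - g s₀‖ := by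
    intro y hy hyδ
    have hn := (hvisit y (by linarith) (hyδ.trans_le (min_le_left _ _))).1
    refine ⟨fun v hv => ?_, fun v hv => ?_⟩ <;> have hv := abs_le.1 hv
    · by_contra! hvn
      exact hn.not_gt (hcluster v (y + s₀) (by linarith) hvn (by linarith) (by linarith))
    · exact hcluster (y + s₀) v (by linarith) hn (by linarith) (by linarith)
  obtain ⟨y₀, hy₀, hy₀δ⟩ := hrec δv hδv0 (b + 3 * T)
  have hgrow : ∀ n : ℕ, ∃ y ≥ b + 3 * T, ‖g y - g 0‖ < δv ∧ d * N y₀ + n ≤ d * N y := by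
    intro n
    induction n with
    | zero => exact ⟨y₀, hy₀, hy₀δ, by simp⟩
    | succ n ih =>
      obtain ⟨y₁, h1, h1δ, h1N⟩ := ih
      obtain ⟨y₂, h2, h2δ, h2σ⟩ := hside δv hδv0 y₁
      obtain ⟨y₃, h3, h3δ⟩ := hrec δv hδv0 (y₂ + T)
      have hy₂ : b + 3 * T ≤ y₂ := h1.trans h2
      have e1 := hmono y₁ y₂ h1 h2 (hgood y₁ h1 h1δ).1 (hgood y₂ hy₂ h2δ).1
      have e2 := hmono (y₂ + T) y₃ (by linarith) h3 (hgood y₂ hy₂ h2δ).2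
        (hgood y₃ (by linarith) h3δ).1
      have e3 := abs_le.1 ((hfolp y₂ (by linarith) (h2δ.trans_le
        ((min_le_right _ _).trans (min_le_right _ _)))).abs_peak_sub_le hg hT0.le)
      rw [hadd y₂ hy₂ (h2δ.trans_le (min_le_left _ _)) (by
        rcases hσ with rfl | rfl
        · exact Or.inl ⟨by linarith [e3.1], by linarith⟩
        · exact Or.inr ⟨by linarith, by linarith [e3.2]⟩)] at e2
      have e4 : 1 ≤ d * d := Order.one_le_iff_pos.2 (mul_self_pos.2 hd0)
      refine ⟨y₃, by linarith, h3δ, ?_⟩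
      push_cast
      linarith
  obtain ⟨n, hn⟩ := exists_nat_gt (|(d : ℝ)| * C - d * N y₀)
  obtain ⟨y, hy, hyδ, hyN⟩ := hgrow n
  have h1 := hbdd y hy (hyδ.trans_le ((min_le_right _ _).trans (min_le_left _ _)))
  have h2 : (d * N y₀ + n : ℝ) ≤ d * N y := by exact_mod_cast hyN
  have h3 : (d * N y : ℝ) ≤ |(d : ℝ)| * C := calc
    _ ≤ |(d : ℝ) * N y| := le_abs_self _
    _ = |(d : ℝ)| * |(N y : ℝ)| := abs_mul _ _
    _ ≤ _ := by gcongr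
  linarith

theorem Shadowing.const_mul {g : ℝ → ℂ} (h : Shadowing g) {w : ℂ} (hw : w ≠ 0) :
    Shadowing fun t => w * g t := by
  intro T hT ε hε
  have hw0 : 0 < ‖w‖ := norm_pos_iff.2 hw
  obtain ⟨δ, hδ, hsh⟩ := h T hT (ε / ‖w‖) (by positivity)
  refine ⟨‖w‖ * δ, by positivity, fun s hs y hy hlt r hr => ?_⟩
  rw [← mul_sub, norm_mul] at hlt ⊢
  have := hsh s hs y hy ((mul_lt_mul_iff_right₀ hw0).1 hlt) r hr
  rwa [lt_div_iff₀ hw0, mul_comm] at this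

theorem not_recurrent_of_shadowing {g : ℝ → ℂ} (hg : Continuous g)
    (hinj : Set.InjOn g (Set.Ici 0)) (hsh : Shadowing g) :
    ¬ ∀ ε > 0, ∀ R, ∃ t ≥ R, ‖g t - g 0‖ < ε := by
  intro hrec
  have h1 : 0 < ‖g 1 - g 0‖ := norm_pos_iff.2 fun h => one_ne_zero
    (hinj (Set.mem_Ici.2 zero_le_one) (Set.mem_Ici.2 le_rfl) (sub_eq_zero.1 h))
  obtain ⟨T, hT, hTlt⟩ := hrec _ h1 2
  obtain ⟨s₀, hs₀, hmax⟩ := isCompact_Icc.exists_isMaxOn (Set.nonempty_Icc.2 (by linarith))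
    (f := fun t => ‖g t - g 0‖) (s := Set.Icc 0 T) (by fun_prop)
  have hle : ∀ t ∈ Set.Icc 0 T, ‖g t - g 0‖ ≤ ‖g s₀ - g 0‖ := fun t ht => hmax ht
  have h1s := hle 1 ⟨zero_le_one, by linarith⟩
  have hw : g s₀ - g 0 ≠ 0 := norm_pos_iff.1 (h1.trans_le h1s)
  have h0 : 0 < s₀ := lt_of_le_of_ne hs₀.1 (by rintro rfl; exact hw (sub_self _))
  have hsT : s₀ < T := lt_of_le_of_ne hs₀.2 (by rintro rfl; linarith)
  have hw' : (starRingEnd ℂ) (g s₀ - g 0) ≠ 0 := (map_ne_zero _).2 hw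
  refine not_recurrent_of_isolated_peak (g := fun t => (starRingEnd ℂ) (g s₀ - g 0) * g t)
    (by fun_prop) (fun a ha b hb hab => hinj ha hb (mul_left_cancel₀ hw' hab))
    (hsh.const_mul hw') h0 hsT (fun s hs hne => ?_) fun ε hε R => ?_
  · have h2 := hle s hs
    have h3 : 0 < ‖g s - g s₀‖ := norm_pos_iff.2 fun h => hne
      (hinj (Set.mem_Ici.2 hs.1) (Set.mem_Ici.2 h0.le) (sub_eq_zero.1 h))
    have h4 := pow_le_pow_left₀ (norm_nonneg _) h2 2
    have h5 := pow_pos h3 2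
    rw [Complex.sq_norm, Complex.normSq_apply] at h4 h5
    rw [Complex.sq_norm, Complex.normSq_apply] at h4
    simp only [Complex.mul_re, Complex.conj_re, Complex.conj_im, Complex.sub_re, Complex.sub_im]
      at h4 h5 ⊢
    linarith
  · have hn : 0 < ‖(starRingEnd ℂ) (g s₀ - g 0)‖ := norm_pos_iff.2 hw'
    obtain ⟨t, ht, hlt⟩ := hrec (ε / ‖(starRingEnd ℂ) (g s₀ - g 0)‖) (by positivity) R
    refine ⟨t, ht, ?_⟩
    rw [← mul_sub, norm_mul]
    rwa [lt_div_iff₀ hn, mul_comm] at hlt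

theorem interior_image_Icc_eq_empty {g : ℝ → ℂ} {a b : ℝ} (hg : ContinuousOn g (Set.Icc a b))
    (hinj : Set.InjOn g (Set.Icc a b)) : interior (g '' Set.Icc a b) = ∅ := by
  by_contra hne
  obtain ⟨c, hc⟩ := Set.nonempty_iff_ne_empty.2 hne
  obtain ⟨r, hr, hball⟩ := Metric.mem_nhds_iff.1 (mem_interior_iff_mem_nhds.1 hc)
  have hG : IsClosedEmbedding ((Set.Icc a b).domRestrict g) :=
    hg.domRestrict.isClosedEmbedding (Set.injOn_iff_injective.1 hinj)
  have hex : ∀ φ : ℝ, ∃ k : Set.Icc a b, (Set.Icc a b).domRestrict g k = circleMap c (r / 2) φ := by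
    intro φ
    obtain ⟨t, ht, htg⟩ := hball (show circleMap c (r / 2) φ ∈ Metric.ball c r by
      rw [Metric.mem_ball, dist_eq_norm, circleMap_sub_center, norm_circleMap_zero,
        abs_of_pos (by positivity)]
      linarith)
    exact ⟨⟨t, ht⟩, htg⟩
  choose k hk using hex
  have hkc : Continuous k := by
    rw [hG.isInducing.continuous_iff]
    exact (continuous_circleMap c (r / 2)).congr fun φ => (hk φ).symm
  have hper : k (Real.pi + Real.pi) = k 0 := hG.injective (by
    rw [hk, hk]
    simpa [two_mul] using (periodic_circleMap c (r / 2)) 0)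
  let f : ℝ → ℝ := fun φ => k φ - k (φ + Real.pi)
  have hf : Continuous f := by fun_prop
  have hpi : f Real.pi = - f 0 := by simp only [f, hper, zero_add]; ring
  obtain ⟨φ, hφ⟩ : (0 : ℝ) ∈ Set.range f := by
    rcases le_total (f 0) 0 with h | h
    · exact mem_range_of_exists_le_of_exists_ge hf ⟨0, h⟩ ⟨Real.pi, by linarith⟩
    · exact mem_range_of_exists_le_of_exists_ge hf ⟨Real.pi, by linarith⟩ ⟨0, h⟩
  have h1 : k φ = k (φ + Real.pi) := Subtype.ext (sub_eq_zero.1 hφ)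
  have h2 := hk φ
  rw [h1, hk] at h2
  simp only [circleMap, Complex.ofReal_add, add_mul, Complex.exp_add, Complex.exp_pi_mul_I] at h2
  have h3 : (r : ℂ) * Complex.exp (φ * Complex.I) = 0 := by
    push_cast at h2
    linear_combination -h2
  simp [hr.ne'] at h3

theorem not_surjOn_of_injOn_Ioi {g : ℝ → ℂ} (hg : ContinuousOn g (Set.Ioi 0))
    (hinj : Set.InjOn g (Set.Ioi 0)) : ¬ Set.SurjOn g (Set.Ioi 0) Set.univ := by
  intro hsurj
  have hsub : ∀ n : ℕ, Set.Icc (1 / ((n : ℝ) + 1)) (n + 1) ⊆ Set.Ioi (0 : ℝ) := fun n x hx =>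
    lt_of_lt_of_le (by positivity) hx.1
  obtain ⟨n, hn⟩ := nonempty_interior_of_iUnion_of_closed
    (f := fun n : ℕ => g '' Set.Icc (1 / ((n : ℝ) + 1)) (n + 1))
    (fun n => (isCompact_Icc.image_of_continuousOn (hg.mono (hsub n))).isClosed) (by
      refine Set.eq_univ_of_forall fun w => ?_
      obtain ⟨t, ht, rfl⟩ := hsurj (Set.mem_univ w)
      have ht0 : (0 : ℝ) < t := ht
      obtain ⟨n, hn⟩ := exists_nat_ge (max t (1 / t))
      refine Set.mem_iUnion.2 ⟨n, t, ⟨?_, ?_⟩, rfl⟩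
      · rw [one_div_le (by positivity) ht0]
        linarith [le_max_right t (1 / t)]
      · linarith [le_max_left t (1 / t)])
  rw [interior_image_Icc_eq_empty (hg.mono (hsub n)) (hinj.mono (hsub n))] at hn
  exact hn.ne_empty rfl

section Sphere

local notation "𝕊" => Metric.sphere (0 : EuclideanSpace ℝ (Fin 3)) 1

/-- Stereographic projection of the two-sphere onto the complex plane. -/
noncomputable def stereoChart (e : 𝕊) : OpenPartialHomeomorph 𝕊 ℂ :=
  haveI : Fact (Module.finrank ℝ (EuclideanSpace ℝ (Fin 3)) = 2 + 1) := ⟨by simp⟩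
  (stereographic' 2 e).transHomeomorph Complex.orthonormalBasisOneI.repr.symm.toHomeomorph

theorem stereoChart_source (e : 𝕊) : (stereoChart e).source = {e}ᶜ := by
  simp [stereoChart]

theorem stereoChart_target (e : 𝕊) : (stereoChart e).target = Set.univ := by
  simp [stereoChart]

theorem exists_forall_ne_of_injOn {u : ℝ → 𝕊} (hu : Continuous u)
    (hinj : Set.InjOn u (Set.Ici 0)) : ∃ e, ∀ t ≥ 0, u t ≠ e := by
  by_contra! h
  have hsrc : ∀ t ∈ Set.Ioi (0 : ℝ), u t ∈ (stereoChart (u 0)).source := by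
    intro t ht
    have ht0 : (0 : ℝ) < t := ht
    rw [stereoChart_source]
    exact fun h0 => ht0.ne' (hinj (Set.mem_Ici.2 ht0.le) (Set.mem_Ici.2 le_rfl) h0)
  refine not_surjOn_of_injOn_Ioi (g := fun t => stereoChart (u 0) (u t)) ?_ ?_ ?_
  · exact (stereoChart (u 0)).continuousOn.comp hu.continuousOn hsrc
  · intro a ha b hb hab
    exact hinj (Set.Ioi_subset_Ici_self ha) (Set.Ioi_subset_Ici_self hb)
      ((stereoChart (u 0)).injOn (hsrc a ha) (hsrc b hb) hab)
  · intro w _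
    have hw : w ∈ (stereoChart (u 0)).target := by simp [stereoChart_target]
    obtain ⟨t, ht, htw⟩ := h ((stereoChart (u 0)).symm w)
    have hs := (stereoChart (u 0)).map_target hw
    rw [stereoChart_source] at hs
    refine ⟨t, lt_of_le_of_ne ht ?_, ?_⟩
    · rintro rfl
      exact hs htw.symm
    · simp only [htw, (stereoChart (u 0)).right_inv hw]

/-- Shadowing is preserved by passing to a chart. -/
theorem Shadowing.chart {u : ℝ → 𝕊} (hu : Continuous u)
    (hsh : Shadowing fun t => (u t : EuclideanSpace ℝ (Fin 3))) (φ : OpenPartialHomeomorph 𝕊 ℂ)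
    (hs : ∀ t ≥ 0, u t ∈ φ.source) {g : ℝ → ℂ} (hg : Continuous g)
    (hgu : ∀ t ≥ 0, g t = φ (u t)) : Shadowing g := by
  intro T hT ε hε
  obtain ⟨ε₁, hε₁, h₁⟩ := Metric.mem_uniformity_dist.1
    ((isCompact_Icc.image hu).uniformContinuousAt_of_continuousAt (s := u '' Set.Icc 0 (2 * T)) φ
      (by rintro _ ⟨t, ht, rfl⟩; exact φ.continuousAt (hs t ht.1)) (Metric.dist_mem_uniformity hε))
  obtain ⟨δ₁, hδ₁, h₂⟩ := hsh T hT ε₁ hε₁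
  obtain ⟨δ, hδ, h₃⟩ := Metric.mem_uniformity_dist.1
    ((isCompact_Icc.image hg).uniformContinuousAt_of_continuousAt (s := g '' Set.Icc 0 T) φ.symm
      (by
        rintro _ ⟨t, ht, rfl⟩
        rw [hgu t ht.1]
        exact φ.symm.continuousAt (φ.map_source (hs t ht.1))) (Metric.dist_mem_uniformity hδ₁))
  refine ⟨δ, hδ, fun s hs' y hy hlt r hr => ?_⟩
  have h4 := h₃ (a := g s) (b := g y) (by rwa [dist_comm, dist_eq_norm]) ⟨s, hs', rfl⟩
  simp only [Set.mem_ofPred_eq, hgu s hs'.1, hgu y hy, φ.left_inv (hs _ hs'.1),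
    φ.left_inv (hs _ hy)] at h4
  rw [dist_comm, Subtype.dist_eq, dist_eq_norm] at h4
  have h5 := h₂ s hs' y hy h4 r hr
  have h6 := h₁ (a := u (s + r)) (b := u (y + r))
    (by rwa [dist_comm, Subtype.dist_eq, dist_eq_norm])
    ⟨s + r, ⟨by linarith [hs'.1, hr.1], by linarith [hs'.2, hr.2]⟩, rfl⟩
  rw [hgu _ (by linarith [hr.1]), hgu _ (by linarith [hr.1, hs'.1]), ← dist_eq_norm, dist_comm]
  exact h6

theorem not_recurrent_of_shadowing_sphere {u : ℝ → 𝕊} (hu : Continuous u)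
    (hinj : Set.InjOn u (Set.Ici 0))
    (hsh : Shadowing fun t => (u t : EuclideanSpace ℝ (Fin 3))) :
    ¬ ∀ ε > 0, ∀ R, ∃ t ≥ R, dist (u t) (u 0) < ε := by
  intro hrec
  obtain ⟨e, he⟩ := exists_forall_ne_of_injOn hu hinj
  have hs : ∀ t ≥ 0, u t ∈ (stereoChart e).source := by
    intro t ht
    rw [stereoChart_source]
    exact he t ht
  let g : ℝ → ℂ := fun t => stereoChart e (u (max t 0))
  have hgu : ∀ t ≥ 0, g t = stereoChart e (u t) := fun t ht => by simp only [g, max_eq_left ht]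
  have hg : Continuous g := (stereoChart e).continuousOn.comp_continuous (by fun_prop)
    fun t => hs _ (le_max_right _ _)
  refine not_recurrent_of_shadowing hg ?_ (hsh.chart hu _ hs hg hgu) fun ε hε R => ?_
  · intro a ha b hb hab
    rw [hgu a ha, hgu b hb] at hab
    exact hinj ha hb ((stereoChart e).injOn (hs a ha) (hs b hb) hab)
  · obtain ⟨δ, hδ, h⟩ := Metric.continuousAt_iff.1
      ((stereoChart e).continuousAt (hs 0 le_rfl)) ε hε
    obtain ⟨t, ht, hlt⟩ := hrec δ hδ (max R 0)
    refine ⟨t, (le_max_left _ _).trans ht, ?_⟩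
    rw [hgu t ((le_max_right _ _).trans ht), hgu 0 le_rfl, ← dist_eq_norm]
    exact h hlt

end Sphere

section Projective

local notation "𝔼" => EuclideanSpace ℝ (Fin 3)
local notation "𝕊" => Metric.sphere (0 : EuclideanSpace ℝ (Fin 3)) 1
local notation "ℙ" => Projectivization ℝ (EuclideanSpace ℝ (Fin 3))

/-- The line spanned by a unit vector. -/
noncomputable def sphereLine (u : 𝕊) : ℙ :=
  Projectivization.mk ℝ (u : 𝔼) (ne_zero_of_mem_unit_sphere u)

/-- The matrix of the orthogonal projection onto a line. -/
noncomputable def lineMatrix : ℙ → Fin 3 → Fin 3 → ℝ :=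
  Projectivization.lift (fun v i j => v.1 i * v.1 j / ‖v.1‖ ^ 2) (by
    rintro ⟨v, hv⟩ ⟨w, hw⟩ t h
    have h' : v = t • w := h
    subst h'
    have ht : t ≠ 0 := by
      rintro rfl
      simp at hv
    have := norm_ne_zero_iff.2 hw
    ext i j
    simp only [PiLp.smul_apply, smul_eq_mul, norm_smul, mul_pow, Real.norm_eq_abs, sq_abs]
    field_simp)

theorem continuous_lineMatrix : Continuous lineMatrix := by
  refine Continuous.quotient_lift
    (f := fun (v : {v : 𝔼 // v ≠ 0}) i j => v.1 i * v.1 j / ‖v.1‖ ^ 2) ?_ _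
  refine continuous_pi fun i => continuous_pi fun j => Continuous.div (by fun_prop) (by fun_prop) ?_
  intro v
  have := norm_ne_zero_iff.2 v.2
  positivity

theorem continuous_sphereLine : Continuous sphereLine :=
  continuous_quotient_mk'.comp
    (continuous_subtype_val.subtype_mk fun u : 𝕊 => ne_zero_of_mem_unit_sphere u)

theorem sphereLine_surjective : Function.Surjective sphereLine := by
  intro x
  induction x using Projectivization.ind with
  | h v hv =>
    refine ⟨⟨‖v‖⁻¹ • v, by simp [norm_smul, hv]⟩, ?_⟩
    rw [sphereLine, Projectivization.mk_eq_mk_iff']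
    exact ⟨‖v‖⁻¹, rfl⟩

theorem sphereLine_eq_iff {u w : 𝕊} : sphereLine u = sphereLine w ↔ u = w ∨ u = -w := by
  rw [sphereLine, sphereLine, Projectivization.mk_eq_mk_iff']
  constructor
  · rintro ⟨a, ha⟩
    have := congrArg norm ha
    rw [norm_smul, norm_eq_of_mem_sphere, norm_eq_of_mem_sphere, mul_one, Real.norm_eq_abs] at this
    rcases (abs_eq zero_le_one).1 this with rfl | rfl
    · exact Or.inl (Subtype.ext (by simpa using ha.symm))
    · exact Or.inr (Subtype.ext (by simpa using ha.symm))
  · rintro (rfl | rfl)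
    · exact ⟨1, one_smul _ _⟩
    · exact ⟨-1, by simp⟩

/-- The squared cosine of the angle between two lines. -/
noncomputable def overlap (x y : ℙ) : ℝ := ∑ i, ∑ j, lineMatrix x i j * lineMatrix y i j

theorem continuous_overlap : Continuous fun p : ℙ × ℙ => overlap p.1 p.2 := by
  have := continuous_lineMatrix
  unfold overlap
  fun_prop

theorem overlap_sphereLine (u w : 𝕊) :
    overlap (sphereLine u) (sphereLine w) = inner ℝ (u : 𝔼) (w : 𝔼) ^ 2 := by
  simp only [overlap, sphereLine, lineMatrix, Projectivization.lift_mk, norm_eq_of_mem_sphere,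
    PiLp.inner_apply, RCLike.inner_apply, conj_trivial, Fin.sum_univ_three]
  ring

theorem inner_eq_one_sub_dist_sq (u w : 𝕊) : inner ℝ (u : 𝔼) (w : 𝔼) = 1 - dist u w ^ 2 / 2 := by
  rw [Subtype.dist_eq, dist_eq_norm, norm_sub_sq_real, norm_eq_of_mem_sphere,
    norm_eq_of_mem_sphere]
  ring

theorem abs_inner_sphere_le_one (u w : 𝕊) : |inner ℝ (u : 𝔼) (w : 𝔼)| ≤ 1 := by
  simpa using abs_real_inner_le_norm (u : 𝔼) (w : 𝔼)

theorem overlap_le_one (x y : ℙ) : overlap x y ≤ 1 := by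
  obtain ⟨u, rfl⟩ := sphereLine_surjective x
  obtain ⟨w, rfl⟩ := sphereLine_surjective y
  rw [overlap_sphereLine, sq_le_one_iff_abs_le_one]
  exact abs_inner_sphere_le_one u w

theorem overlap_eq_one_iff {x y : ℙ} : overlap x y = 1 ↔ x = y := by
  obtain ⟨u, rfl⟩ := sphereLine_surjective x
  obtain ⟨w, rfl⟩ := sphereLine_surjective y
  rw [overlap_sphereLine, sphereLine_eq_iff, sq_eq_one_iff,
    inner_eq_one_iff_of_norm_eq_one (𝕜 := ℝ) (norm_eq_of_mem_sphere u) (norm_eq_of_mem_sphere w)]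
  constructor
  · rintro (h | h)
    · exact Or.inl (Subtype.ext h)
    · refine Or.inr (Subtype.ext ?_)
      rw [← inner_eq_one_iff_of_norm_eq_one (𝕜 := ℝ) (norm_eq_of_mem_sphere u)
        (norm_eq_of_mem_sphere (-w))]
      simp [inner_neg_right, h]
  · rintro (rfl | rfl)
    · exact Or.inl rfl
    · refine Or.inr ?_
      simp [inner_neg_left]

instance : T2Space ℙ := by
  refine T2Space.of_injective_continuous (f := lineMatrix) (fun x y h => ?_) continuous_lineMatrix
  have : overlap x x = 1 := overlap_eq_one_iff.2 rfl
  refine overlap_eq_one_iff.1 ?_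
  rw [← this, overlap, overlap, h]

theorem isQuotientCoveringMap_sphereLine :
    IsQuotientCoveringMap sphereLine (Metric.sphere (0 : ℝ) 1) where
  toIsQuotientMap := IsQuotientMap.of_surjective_continuous sphereLine_surjective
    continuous_sphereLine
  continuous_const_smul g := continuous_const_smul g
  apply_eq_iff_mem_orbit {u w} := by
    rw [sphereLine_eq_iff]
    constructor
    · rintro (rfl | rfl)
      · exact ⟨1, one_smul _ _⟩
      · exact ⟨-1, Subtype.ext (neg_one_smul ℝ (w : 𝔼))⟩
    · rintro ⟨⟨a, ha⟩, rfl⟩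
      have ha' : |a| = 1 := by simpa using ha
      rcases (abs_eq zero_le_one).1 ha' with rfl | rfl
      · exact Or.inl (Subtype.ext (one_smul _ _))
      · exact Or.inr (Subtype.ext (neg_one_smul ℝ (w : 𝔼)))
  disjoint u := by
    refine ⟨{x : 𝕊 | 0 < inner ℝ (x : 𝔼) (u : 𝔼)},
      (isOpen_lt continuous_const (by fun_prop)).mem_nhds (by simp), ?_⟩
    rintro ⟨a, ha⟩ ⟨_, ⟨x, hx, rfl⟩, hy⟩
    have ha' : |a| = 1 := by simpa using ha
    rcases (abs_eq zero_le_one).1 ha' with rfl | rfl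
    · rfl
    · have h1 : 0 < inner ℝ (x : 𝔼) (u : 𝔼) := hx
      have h2 : 0 < inner ℝ ((-1 : ℝ) • (x : 𝔼)) (u : 𝔼) := hy
      rw [real_inner_smul_left] at h2
      linarith

theorem exists_lift_sphereLine {γ : ℝ → ℙ} (hγ : Continuous γ) :
    ∃ u : ℝ → 𝕊, Continuous u ∧ ∀ t, sphereLine (u t) = γ t := by
  obtain ⟨u₀, hu₀⟩ := sphereLine_surjective (γ 0)
  obtain ⟨L, ⟨-, hL⟩, -⟩ :=
    isQuotientCoveringMap_sphereLine.isCoveringMap.existsUnique_continuousMap_lifts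
      ⟨γ, hγ⟩ 0 u₀ hu₀
  exact ⟨L, L.continuous, congrFun hL⟩

/-- Nearby points of a compact phase space stay nearby for bounded times. -/
theorem exists_forall_overlap_gt {Z : Set ℙ} (hZ : IsCompact Z) {Φ : Z × ℝ≥0 → Z}
    (hΦ : Continuous Φ) (T : ℝ≥0) {ε : ℝ} (hε : 0 < ε) :
    ∃ δ > 0, ∀ x y : Z, 1 - δ < overlap x y → ∀ r ≤ T,
      1 - ε < overlap (Φ (x, r)) (Φ (y, r)) := by
  have : CompactSpace Z := isCompact_iff_compactSpace.1 hZ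
  have hc : Continuous fun p : ℙ × ℙ => overlap p.1 p.2 := continuous_overlap
  let K : Set (Z × Z × ℝ≥0) := (Set.univ ×ˢ Set.univ ×ˢ Set.Icc 0 T) ∩
    {p | overlap (Φ (p.1, p.2.2)) (Φ (p.2.1, p.2.2)) ≤ 1 - ε}
  have hK : IsCompact K := by
    refine ((isCompact_univ.prod (isCompact_univ.prod isCompact_Icc))).inter_right
      (isClosed_le ?_ continuous_const)
    exact hc.comp (by fun_prop : Continuous fun p : Z × Z × ℝ≥0 =>
      ((Φ (p.1, p.2.2) : ℙ), (Φ (p.2.1, p.2.2) : ℙ)))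
  rcases K.eq_empty_or_nonempty with he | hne
  · refine ⟨1, one_pos, fun x y _ r hr => ?_⟩
    by_contra! h
    have : (x, y, r) ∈ K := ⟨⟨trivial, trivial, zero_le, hr⟩, h⟩
    rw [he] at this
    exact this
  · obtain ⟨p, hp, hmax⟩ := hK.exists_isMaxOn hne
      (f := fun p : Z × Z × ℝ≥0 => overlap p.1 p.2.1)
      (hc.comp (by fun_prop : Continuous fun p : Z × Z × ℝ≥0 =>
        ((p.1 : ℙ), (p.2.1 : ℙ)))).continuousOn
    refine ⟨1 - overlap p.1 p.2.1, ?_, fun x y hxy r hr => ?_⟩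
    · refine sub_pos.2 (lt_of_le_of_ne (overlap_le_one _ _) fun h => ?_)
      have h1 : p.1 = p.2.1 := Subtype.ext (overlap_eq_one_iff.1 h)
      have h2 := hp.2
      rw [Set.mem_ofPred_eq, h1, overlap_eq_one_iff.2 rfl] at h2
      linarith
    · by_contra! h
      have h3 := hmax (a := (x, y, r)) ⟨⟨trivial, trivial, zero_le, hr⟩, h⟩
      simp only [Set.mem_ofPred_eq] at h3
      linarith

theorem dist_lt_of_inner_pos {a b : 𝕊} {ε : ℝ} (hε : 0 < ε)
    (hpos : 0 < inner ℝ (a : 𝔼) (b : 𝔼)) (h : 1 - ε ^ 2 / 2 < inner ℝ (a : 𝔼) (b : 𝔼) ^ 2) :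
    dist a b < ε := by
  have h1 := (abs_le.1 (abs_inner_sphere_le_one a b)).2
  have h2 := inner_eq_one_sub_dist_sq a b
  refine lt_of_pow_lt_pow_left₀ 2 hε.le ?_
  nlinarith

theorem dist_lt_or_dist_neg_lt {a b : 𝕊} {ε : ℝ} (hε : 0 < ε) (hε1 : ε ≤ 1)
    (h : 1 - ε ^ 2 / 2 < inner ℝ (a : 𝔼) (b : 𝔼) ^ 2) : dist a b < ε ∨ dist a (-b) < ε := by
  rcases lt_trichotomy (inner ℝ (a : 𝔼) (b : 𝔼)) 0 with hlt | heq | hgt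
  · refine Or.inr (dist_lt_of_inner_pos hε ?_ ?_)
    · simpa [inner_neg_right] using hlt
    · simpa [inner_neg_right] using h
  · rw [heq] at h
    nlinarith
  · exact Or.inl (dist_lt_of_inner_pos hε hgt h)

theorem dist_lt_of_forall_overlap_gt {a b : ℝ → 𝕊} (ha : Continuous a) (hb : Continuous b)
    {T ε : ℝ} (hε : 0 < ε) (hε1 : ε ≤ 1) (h0 : 0 < inner ℝ (a 0 : 𝔼) (b 0 : 𝔼))
    (h : ∀ r ∈ Set.Icc 0 T, 1 - ε ^ 2 / 2 < overlap (sphereLine (a r)) (sphereLine (b r))) :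
    ∀ r ∈ Set.Icc 0 T, dist (a r) (b r) < ε := by
  intro r hr
  refine dist_lt_of_inner_pos hε ?_ (by rw [← overlap_sphereLine]; exact h r hr)
  by_contra! hle
  obtain ⟨q, hq, hq0⟩ := intermediate_value_Icc' hr.1
    (f := fun q => inner ℝ (a q : 𝔼) (b q : 𝔼)) (by fun_prop) ⟨hle, h0.le⟩
  have := h q ⟨hq.1, hq.2.trans hr.2⟩
  rw [overlap_sphereLine] at this
  simp only at hq0
  rw [hq0] at this
  nlinarith

/-- Shadowing of lines lifts to shadowing of unit vectors, up to a common sign. -/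
theorem exists_forall_dist_lt {u : ℝ → 𝕊} (hu : Continuous u)
    (hov : ∀ T > 0, ∀ ε > 0, ∃ δ > 0, ∀ s ≥ 0, ∀ y ≥ 0,
      1 - δ < overlap (sphereLine (u y)) (sphereLine (u s)) → ∀ r ∈ Set.Icc 0 T,
        1 - ε < overlap (sphereLine (u (y + r))) (sphereLine (u (s + r))))
    {w : ℝ → 𝕊} (hw : w = u ∨ w = -u) {T : ℝ} (hT : 0 < T) {ε : ℝ} (hε : 0 < ε) :
    ∃ δ > 0, ∀ s ≥ 0, ∀ y ≥ 0, dist (u y) (w s) < δ →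
      ∀ r ∈ Set.Icc 0 T, dist (u (y + r)) (w (s + r)) < ε := by
  have hwl : ∀ t, sphereLine (w t) = sphereLine (u t) := by
    intro t
    rw [sphereLine_eq_iff]
    rcases hw with rfl | rfl
    · exact Or.inl rfl
    · exact Or.inr rfl
  have hwc : Continuous w := by
    rcases hw with rfl | rfl
    · exact hu
    · exact hu.neg
  have hm : 0 < min ε 1 := by positivity
  obtain ⟨δ, hδ, h⟩ := hov T hT ((min ε 1) ^ 2 / 2) (by positivity)
  refine ⟨min δ 1, by positivity, fun s hs y hy hlt r hr => ?_⟩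
  have h1 := inner_eq_one_sub_dist_sq (u y) (w s)
  have h2 : dist (u y) (w s) < 1 := hlt.trans_le (min_le_right _ _)
  have h3 : dist (u y) (w s) < δ := hlt.trans_le (min_le_left _ _)
  have h4 := dist_nonneg (x := u y) (y := w s)
  have h5 : dist (u y) (w s) ^ 2 < δ := by nlinarith
  have h6 : dist (u y) (w s) ^ 2 < 1 := by nlinarith
  refine (dist_lt_of_forall_overlap_gt (a := fun r => u (y + r)) (b := fun r => w (s + r))
    (T := T) (by fun_prop) (by fun_prop) hm (min_le_right _ _) ?_ ?_ r hr).trans_le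
    (min_le_left _ _)
  · simp only [add_zero, h1]
    linarith
  · intro r hr
    simp only [hwl]
    refine h s hs y hy ?_ r hr
    rw [← hwl s, overlap_sphereLine, h1]
    nlinarith

/-- A lift to the sphere of a recurrent curve in the projective plane is recurrent. -/
theorem recurrent_of_recurrent_up_to_sign {u : ℝ → 𝕊}
    (hsh : ∀ T > 0, ∀ ε > 0, ∃ δ > 0, ∀ s ≥ 0, ∀ y ≥ 0, dist (u y) (-u s) < δ →
      ∀ r ∈ Set.Icc 0 T, dist (u (y + r)) (-u (s + r)) < ε)
    (hrec : ∀ ε > 0, ∀ R, ∃ t ≥ R, dist (u t) (u 0) < ε ∨ dist (u t) (-u 0) < ε) :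
    ∀ ε > 0, ∀ R, ∃ t ≥ R, dist (u t) (u 0) < ε := by
  by_contra! hcon
  obtain ⟨ε, hε, R, hfar⟩ := hcon
  obtain ⟨t₁, ht₁, h₁⟩ := hrec (ε / 2) (by positivity) (max R 0)
  obtain ⟨hR₁, h0₁⟩ := max_le_iff.1 ht₁
  have hneg₁ := h₁.resolve_left (by linarith [hfar t₁ hR₁])
  obtain ⟨δ, hδ, h⟩ := hsh (t₁ + 1) (by linarith) (ε / 2) (by positivity)
  obtain ⟨t₂, ht₂, h₂⟩ := hrec (min δ ε) (by positivity) (max R 0)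
  obtain ⟨hR₂, h0₂⟩ := max_le_iff.1 ht₂
  have hneg₂ := h₂.resolve_left (by linarith [hfar t₂ hR₂, min_le_right δ ε])
  have h₃ := h 0 le_rfl t₂ h0₂ (hneg₂.trans_le (min_le_left _ _)) t₁ ⟨h0₁, by linarith⟩
  rw [zero_add] at h₃
  have h₄ : dist (-u t₁) (u 0) = dist (u t₁) (-u 0) := by
    rw [Subtype.dist_eq, Subtype.dist_eq, coe_neg_sphere, coe_neg_sphere, ← dist_neg_neg, neg_neg]
  have h₅ := dist_triangle (u (t₂ + t₁)) (-u t₁) (u 0)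
  linarith [hfar (t₂ + t₁) (by linarith)]

/-- The orbit of a recurrent nonperiodic point is injective. -/
theorem injective_orbit_of_recurrent {X : Type*} [TopologicalSpace X] [T2Space X]
    {Φ : X × ℝ≥0 → X} (hΦ : Continuous Φ)
    (h0 : ∀ z : X, Φ (z, 0) = z)
    (hadd : ∀ (z : X) (s t : ℝ≥0), Φ (Φ (z, s), t) = Φ (z, s + t)) {z : X} {t : ℕ → ℝ≥0}
    (ht : Tendsto t atTop atTop) (htz : Tendsto (fun n => Φ (z, t n)) atTop (𝓝 z))
    (hp : ∀ p, 0 < p → Φ (z, p) ≠ z) : Function.Injective fun s => Φ (z, s) := by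
  have key : ∀ s p : ℝ≥0, 0 < s → 0 < p → Φ (z, s + p) ≠ Φ (z, s) := by
    intro s p hs hp0 heq
    have hper : ∀ r, Φ (z, s + p + r) = Φ (z, s + r) := fun r => by
      rw [← hadd z (s + p), heq, hadd]
    have hmul : ∀ (n : ℕ) (r : ℝ≥0), Φ (z, s + (n * p + r)) = Φ (z, s + r) := by
      intro n
      induction n with
      | zero => simp
      | succ n ih =>
        intro r
        rw [← ih r, ← hper (n * p + r)]
        congr 2
        push_cast
        ring
    have hK : IsClosed ((fun τ => Φ (z, τ)) '' Set.Icc s (s + p)) :=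
      (isCompact_Icc.image (by fun_prop)).isClosed
    have hmem : ∀ τ ≥ s, Φ (z, τ) ∈ (fun τ => Φ (z, τ)) '' Set.Icc s (s + p) := by
      intro τ hτ
      obtain ⟨q, rfl⟩ := exists_add_of_le hτ
      obtain ⟨n, hn, hlt⟩ : ∃ n : ℕ, n * p ≤ q ∧ q < (n + 1) * p :=
        ⟨⌊q / p⌋₊, (le_div_iff₀ hp0).1 (Nat.floor_le zero_le),
          (div_lt_iff₀ hp0).1 (Nat.lt_floor_add_one _)⟩
      obtain ⟨r, rfl⟩ := exists_add_of_le hn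
      refine ⟨s + r, ⟨le_self_add, ?_⟩, ?_⟩
      · gcongr
        rw [add_mul, one_mul] at hlt
        exact (lt_of_add_lt_add_left hlt).le
      · exact (hmul _ _).symm
    obtain ⟨τ, hτ, hτz⟩ := hK.mem_of_tendsto htz
      ((ht.eventually_ge_atTop s).mono fun n hn => hmem _ hn)
    exact hp τ (hs.trans_le hτ.1) hτz
  have hlt : ∀ a b : ℝ≥0, a < b → Φ (z, a) ≠ Φ (z, b) := by
    intro a b hab heq
    rcases eq_zero_or_pos a with rfl | ha
    · exact hp b hab (by rw [← heq, h0])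
    · refine key a (b - a) ha (tsub_pos_of_lt hab) ?_
      rw [add_tsub_cancel_of_le hab.le, heq]
  intro a b hab
  rcases lt_trichotomy a b with h | h | h
  · exact (hlt a b h hab).elim
  · exact h
  · exact (hlt b a h hab.symm).elim

end Projective

/-- Poincaré–Bendixson theorem for continuous semiflows on compact subsets of the real
projective plane `ℝP²`: every recurrent point is a fixed point or a periodic point. -/
theorem semiflow_projective_recurrent_fixed_or_periodic
    (Z : Set (Projectivization ℝ (EuclideanSpace ℝ (Fin 3)))) (hZc : IsCompact Z)
    (Φ : Z × ℝ≥0 → Z) (hΦ : Continuous Φ)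
    (h0 : ∀ z : Z, Φ (z, 0) = z)
    (hadd : ∀ (z : Z) (s t : ℝ≥0), Φ (Φ (z, s), t) = Φ (z, s + t))
    (z : Z)
    (hrec : ∃ t : ℕ → ℝ≥0, Tendsto t atTop atTop ∧
      Tendsto (fun n => Φ (z, t n)) atTop (𝓝 z)) :
    (∀ t : ℝ≥0, Φ (z, t) = z) ∨ (∃ p : ℝ≥0, 0 < p ∧ Φ (z, p) = z) := by
  refine or_iff_not_imp_right.2 fun hno => False.elim ?_
  push Not at hno
  obtain ⟨t, ht, htz⟩ := hrec
  have hinj := injective_orbit_of_recurrent hΦ h0 hadd ht htz hno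
  have hγ : Continuous fun τ : ℝ => (Φ (z, τ.toNNReal)).1 := by fun_prop
  obtain ⟨u, hu, huγ⟩ := exists_lift_sphereLine hγ
  have hov : ∀ T > 0, ∀ ε > 0, ∃ δ > 0, ∀ s ≥ 0, ∀ y ≥ 0,
      1 - δ < overlap (sphereLine (u y)) (sphereLine (u s)) → ∀ r ∈ Set.Icc 0 T,
        1 - ε < overlap (sphereLine (u (y + r))) (sphereLine (u (s + r))) := by
    intro T hT ε hε
    obtain ⟨δ, hδ, h⟩ := exists_forall_overlap_gt hZc hΦ T.toNNReal hε
    refine ⟨δ, hδ, fun s hs y hy hlt r hr => ?_⟩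
    rw [huγ, huγ] at hlt ⊢
    have := h _ _ hlt r.toNNReal (Real.toNNReal_le_toNNReal hr.2)
    rwa [hadd, hadd, ← Real.toNNReal_add hy hr.1, ← Real.toNNReal_add hs hr.1] at this
  have hrec' : ∀ ε > 0, ∀ R, ∃ t ≥ R, dist (u t) (u 0) < ε ∨ dist (u t) (-u 0) < ε := by
    intro ε hε R
    have hm : 0 < min ε 1 := by positivity
    have hlim : Tendsto (fun n => overlap (Φ (z, t n)) z) atTop (𝓝 (overlap z z)) := by
      have : Continuous fun y : Z => overlap y z :=
        continuous_overlap.comp (by fun_prop : Continuous fun y : Z => (y.1, z.1))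
      exact (this.tendsto z).comp htz
    rw [overlap_eq_one_iff.2 rfl] at hlim
    obtain ⟨n, hn, hR⟩ := ((hlim.eventually_const_lt
      (show 1 - (min ε 1) ^ 2 / 2 < 1 by linarith [pow_pos hm 2])).and
        (ht.eventually_ge_atTop R.toNNReal)).exists
    refine ⟨t n, Real.toNNReal_le_iff_le_coe.1 hR, ?_⟩
    have h1 := dist_lt_or_dist_neg_lt (a := u (t n)) (b := u 0) hm (min_le_right _ _) (by
      rwa [← overlap_sphereLine, huγ, huγ, Real.toNNReal_coe, Real.toNNReal_zero, h0])
    exact h1.imp (fun h => h.trans_le (min_le_left _ _)) fun h => h.trans_le (min_le_left _ _)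
  have huinj : Set.InjOn u (Set.Ici 0) := by
    intro a ha b hb hab
    have h1 := congrArg sphereLine hab
    rw [huγ, huγ] at h1
    exact (Real.toNNReal_eq_toNNReal_iff ha hb).1 (hinj (Subtype.ext h1))
  refine not_recurrent_of_shadowing_sphere hu huinj (fun T hT ε hε => ?_)
    (recurrent_of_recurrent_up_to_sign (fun T hT ε hε =>
      exists_forall_dist_lt hu hov (Or.inr rfl) hT hε) hrec')
  obtain ⟨δ, hδ, h⟩ := exists_forall_dist_lt hu hov (Or.inl rfl) hT hε
  refine ⟨δ, hδ, fun s hs y hy hlt r hr => ?_⟩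
  rw [← dist_eq_norm, ← Subtype.dist_eq] at hlt ⊢
  exact h s hs.1 y hy hlt r hr
end

section
/- Let Z ⊂ ℝ^d be compact and let Ψ₁,…,Ψ_N : Z → ℝ^d be continuous. Let 𝔛_Z denote the set of all trajectories of the switched system defined by Ψ₁,…,Ψ_N which take values only in Z. Then 𝔛_Z is a switched Bebutov shift: it is compact in the compact-open topology on C([0,∞),Z), it is shift-invariant, and it satisfies the switching axiom. -/
open scoped NNReal
open Filter Topology MeasureTheory

/-- The shift semiflow `σ^τ` on `C([0,∞), Z)`. -/
noncomputable def bebShift {Z : Type*} [TopologicalSpace Z] (τ : ℝ≥0) (φ : C(ℝ≥0, Z)) :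
    C(ℝ≥0, Z) :=
  φ.comp ⟨fun t => t + τ, continuous_id.add continuous_const⟩

/-- A `Z`-valued switched Bebutov shift: a compact, shift-invariant subset of `C([0,∞), Z)`
(with the compact-open topology) satisfying the switching axiom. -/
def IsSwitchedBebutovShift {Z : Type*} [TopologicalSpace Z] (X : Set C(ℝ≥0, Z)) : Prop :=
  IsCompact X ∧
  (∀ φ ∈ X, ∀ τ : ℝ≥0, bebShift τ φ ∈ X) ∧
  (∀ φ₁ ∈ X, ∀ φ₂ ∈ X, ∀ τ : ℝ≥0, 0 < τ → φ₁ τ = φ₂ τ →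
    ∀ ψ : C(ℝ≥0, Z), (∀ t, t ≤ τ → ψ t = φ₁ t) → (∀ t, τ ≤ t → ψ t = φ₂ t) → ψ ∈ X)

/-- A switching law: measurable functions `u₁,…,u_N : [0,∞) → [0,1]` with `Σᵢ uᵢ(s) = 1`
for a.e. `s ≥ 0` (the `uᵢ` are extended measurably to all of `ℝ`). -/
def IsSwitchingLaw {N : ℕ} (u : Fin N → ℝ → ℝ) : Prop :=
  (∀ i, Measurable (u i)) ∧
  (∀ᵐ s ∂(volume.restrict (Set.Ici (0 : ℝ))),
    (∀ i, u i s ∈ Set.Icc (0 : ℝ) 1) ∧ ∑ i, u i s = 1)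

/-- The set of trajectories of the switched system defined by `Ψ₁,…,Ψ_N` taking values in
`Z`: continuous `x : [0,∞) → Z` with `x(t) = x(0) + ∫₀ᵗ Σᵢ uᵢ(s) Ψᵢ(x(s)) ds` for some
switching law `u`. -/
def trajectoriesIn {d N : ℕ} (Z : Set (EuclideanSpace ℝ (Fin d)))
    (Ψ : Fin N → Z → EuclideanSpace ℝ (Fin d)) : Set C(ℝ≥0, Z) :=
  {x | ∃ u : Fin N → ℝ → ℝ, IsSwitchingLaw u ∧
    ∀ t : ℝ≥0, (x t : EuclideanSpace ℝ (Fin d)) =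
      (x 0 : EuclideanSpace ℝ (Fin d)) +
        ∫ s in Set.Ioc (0 : ℝ) (t : ℝ), ∑ i, u i s • Ψ i (x (Real.toNNReal s))}

section SwitchedSystems

variable {d N : ℕ} {Z : Set (EuclideanSpace ℝ (Fin d))}
  {Ψ : Fin N → Z → EuclideanSpace ℝ (Fin d)}

/-- The cumulative version `U i t = ∫₀ᵗ uᵢ` of a switching law `u`. -/
structure IsCumulativeLaw (U : Fin N → ℝ≥0 → ℝ) : Prop where
  monotone : ∀ i, Monotone (U i)
  nonneg : ∀ i t, 0 ≤ U i t
  sum_eq : ∀ t, ∑ i, U i t = t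

/-- The increments of `x` are those prescribed by the cumulative law `U`, up to the oscillation of
the vector fields along `x`. This is a derivative-free form of `ẋ = ∑ i, U̇ᵢ • Ψᵢ(x)`. -/
def IsDrivenBy (Ψ : Fin N → Z → EuclideanSpace ℝ (Fin d)) (x : C(ℝ≥0, Z))
    (U : Fin N → ℝ≥0 → ℝ) : Prop :=
  ∀ a b : ℝ≥0, a ≤ b → ∀ (v : Fin N → EuclideanSpace ℝ (Fin d)) (ε : ℝ),
    (∀ s ∈ Set.Icc a b, ∀ i, ‖Ψ i (x s) - v i‖ < ε) →
      ‖((x b : EuclideanSpace ℝ (Fin d)) - x a) - ∑ i, (U i b - U i a) • v i‖ ≤ ε * (b - a)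

namespace IsCumulativeLaw

variable {U : Fin N → ℝ≥0 → ℝ}

lemma le_self (hU : IsCumulativeLaw U) (i : Fin N) (t : ℝ≥0) : U i t ≤ t :=
  hU.sum_eq t ▸ Finset.single_le_sum (fun j _ => hU.nonneg j t) (Finset.mem_univ i)

lemma sub_le (hU : IsCumulativeLaw U) (i : Fin N) {s t : ℝ≥0} (hst : s ≤ t) :
    U i t - U i s ≤ t - s := by
  rw [← hU.sum_eq t, ← hU.sum_eq s, ← Finset.sum_sub_distrib]
  exact Finset.single_le_sum (f := fun j => U j t - U j s)
    (fun j _ => sub_nonneg.2 (hU.monotone j hst)) (Finset.mem_univ i)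

lemma lipschitzWith (hU : IsCumulativeLaw U) (i : Fin N) : LipschitzWith 1 (U i) := by
  refine LipschitzWith.of_le_add fun s t => ?_
  rw [NNReal.dist_eq]
  rcases le_total s t with h | h
  · linarith [hU.monotone i h, abs_nonneg ((s : ℝ) - t)]
  · linarith [hU.sub_le i h, le_abs_self ((s : ℝ) - t)]

lemma isClosed : IsClosed {U : Fin N → ℝ≥0 → ℝ | IsCumulativeLaw U} := by
  have : {U : Fin N → ℝ≥0 → ℝ | IsCumulativeLaw U} =
      {U | (∀ i, ∀ s t, s ≤ t → U i s ≤ U i t) ∧ (∀ i t, 0 ≤ U i t) ∧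
        ∀ t : ℝ≥0, ∑ i, U i t = (t : ℝ)} := by
    ext U
    exact ⟨fun h => ⟨fun i s t hst => h.monotone i hst, h.nonneg, h.sum_eq⟩,
      fun h => ⟨fun i s t hst => h.1 i s t hst, h.2.1, h.2.2⟩⟩
  rw [this]
  have hc (i : Fin N) (t : ℝ≥0) : Continuous fun U : Fin N → ℝ≥0 → ℝ => U i t := by fun_prop
  refine IsClosed.and ?_ (IsClosed.and ?_ ?_)
  · simp only [Set.ofPred_forall]
    exact isClosed_iInter fun i => isClosed_iInter fun s => isClosed_iInter fun t =>
      isClosed_iInter fun _ => isClosed_le (hc i s) (hc i t)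
  · simp only [Set.ofPred_forall]
    exact isClosed_iInter fun i => isClosed_iInter fun t =>
      isClosed_le continuous_const (hc i t)
  · simp only [Set.ofPred_forall]
    exact isClosed_iInter fun t =>
      isClosed_eq (continuous_finsetSum _ fun i _ => hc i t) continuous_const

lemma isCompact : IsCompact {U : Fin N → ℝ≥0 → ℝ | IsCumulativeLaw U} := by
  refine IsCompact.of_isClosed_subset
    (isCompact_univ_pi fun _ => isCompact_univ_pi fun t : ℝ≥0 =>
      isCompact_Icc (a := (0 : ℝ)) (b := t))
    isClosed fun U hU i _ t _ => ⟨hU.nonneg i t, hU.le_self i t⟩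

lemma shift (hU : IsCumulativeLaw U) (τ : ℝ≥0) :
    IsCumulativeLaw fun i t => U i (t + τ) - U i τ where
  monotone i s t hst := sub_le_sub_right (hU.monotone i (by gcongr)) _
  nonneg i t := sub_nonneg.2 (hU.monotone i le_add_self)
  sum_eq t := by simp [Finset.sum_sub_distrib, hU.sum_eq]

lemma switch {V : Fin N → ℝ≥0 → ℝ} (hU : IsCumulativeLaw U) (hV : IsCumulativeLaw V) (τ : ℝ≥0) :
    IsCumulativeLaw fun i t => U i (min t τ) + (V i (max t τ) - V i τ) where
  monotone i s t hst := add_le_add (hU.monotone i (by gcongr))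
    (sub_le_sub_right (hV.monotone i (by gcongr)) _)
  nonneg i t := add_nonneg (hU.nonneg i _) (sub_nonneg.2 (hV.monotone i (le_max_right _ _)))
  sum_eq t := by
    simp only [Finset.sum_add_distrib, Finset.sum_sub_distrib, hU.sum_eq, hV.sum_eq]
    push_cast
    linarith [min_add_max (t : ℝ) τ]

end IsCumulativeLaw

namespace IsDrivenBy

variable {x : C(ℝ≥0, Z)} {U : Fin N → ℝ≥0 → ℝ}

lemma shift (hx : IsDrivenBy Ψ x U) (τ : ℝ≥0) :
    IsDrivenBy Ψ (bebShift τ x) fun i t => U i (t + τ) - U i τ := by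
  intro a b hab v ε h
  have := hx (a + τ) (b + τ) (by gcongr) v ε fun s hs i => by
    have hτ : τ ≤ s := le_add_self.trans hs.1
    have := h (s - τ) ⟨le_tsub_of_add_le_right hs.1, tsub_le_iff_right.2 hs.2⟩ i
    simpa [bebShift, tsub_add_cancel_of_le hτ] using this
  simpa [bebShift] using this

lemma switch {y z : C(ℝ≥0, Z)} {V : Fin N → ℝ≥0 → ℝ} {τ : ℝ≥0} (hx : IsDrivenBy Ψ x U)
    (hy : IsDrivenBy Ψ y V) (hzx : ∀ t, t ≤ τ → z t = x t) (hzy : ∀ t, τ ≤ t → z t = y t) :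
    IsDrivenBy Ψ z fun i t => U i (min t τ) + (V i (max t τ) - V i τ) := by
  intro a b hab v ε h
  have before (a b : ℝ≥0) (hab : a ≤ b) (hb : b ≤ τ)
      (h : ∀ s ∈ Set.Icc a b, ∀ i, ‖Ψ i (z s) - v i‖ < ε) :
      ‖((z b : EuclideanSpace ℝ (Fin d)) - z a) - ∑ i, ((U i (min b τ) + (V i (max b τ) - V i τ))
        - (U i (min a τ) + (V i (max a τ) - V i τ))) • v i‖ ≤ ε * (b - a) := by
    have := hx a b hab v ε fun s hs i => hzx s (hs.2.trans hb) ▸ h s hs i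
    simpa [hzx b hb, hzx a (hab.trans hb), hb, hab.trans hb] using this
  have after (a b : ℝ≥0) (hab : a ≤ b) (ha : τ ≤ a)
      (h : ∀ s ∈ Set.Icc a b, ∀ i, ‖Ψ i (z s) - v i‖ < ε) :
      ‖((z b : EuclideanSpace ℝ (Fin d)) - z a) - ∑ i, ((U i (min b τ) + (V i (max b τ) - V i τ))
        - (U i (min a τ) + (V i (max a τ) - V i τ))) • v i‖ ≤ ε * (b - a) := by
    have := hy a b hab v ε fun s hs i => hzy s (ha.trans hs.1) ▸ h s hs i
    simpa [hzy a ha, hzy b (ha.trans hab), ha, ha.trans hab] using this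
  rcases le_total b τ with hb | hb
  · exact before a b hab hb h
  rcases le_total τ a with ha | ha
  · exact after a b hab ha h
  have h₁ := before a τ ha le_rfl fun s hs => h s ⟨hs.1, hs.2.trans hb⟩
  have h₂ := after τ b hb le_rfl fun s hs => h s ⟨ha.trans hs.1, hs.2⟩
  calc _ = _ := congrArg norm ?_
    _ ≤ _ := norm_add_le_of_le h₁ h₂
    _ = _ := by ring
  simp only [sub_smul, Finset.sum_sub_distrib]
  abel

lemma lipschitzWith (hx : IsDrivenBy Ψ x U) {M : ℝ≥0} (hM : ∀ i z, ‖Ψ i z‖ < M) :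
    LipschitzWith M x := by
  have key (a b : ℝ≥0) (hab : a ≤ b) : dist (x a) (x b) ≤ M * dist a b := by
    have := hx a b hab 0 M fun s _ i => by simpa using hM i (x s)
    rw [dist_comm, dist_comm a, Subtype.dist_eq, dist_eq_norm, NNReal.dist_eq,
      abs_of_nonneg (sub_nonneg.2 (NNReal.coe_le_coe.2 hab))]
    simpa using this
  refine LipschitzWith.of_dist_le_mul fun a b => ?_
  rcases le_total a b with h | h
  · exact key a b h
  · rw [dist_comm (x a), dist_comm a]
    exact key b a h

lemma isClosed (hΨ : ∀ i, Continuous (Ψ i)) :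
    IsClosed {p : C(ℝ≥0, Z) × (Fin N → ℝ≥0 → ℝ) | IsDrivenBy Ψ p.1 p.2} := by
  simp only [IsDrivenBy, Set.ofPred_forall]
  refine isClosed_iInter fun a => isClosed_iInter fun b => isClosed_iInter fun _ =>
    isClosed_iInter fun v => isClosed_iInter fun ε => isClosed_imp ?_ (isClosed_le ?_ ?_)
  · have hW : IsOpen {z : Z | ∀ i, ‖Ψ i z - v i‖ < ε} := by
      simp only [Set.ofPred_forall]
      exact isOpen_iInter_of_finite fun i =>
        isOpen_lt (by have := hΨ i; fun_prop) continuous_const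
    exact (ContinuousMap.isOpen_setOfPred_mapsTo (isCompact_Icc (a := a) (b := b)) hW).preimage
      continuous_fst
  · have hev (t : ℝ≥0) : Continuous fun p : C(ℝ≥0, Z) × (Fin N → ℝ≥0 → ℝ) =>
        (p.1 t : EuclideanSpace ℝ (Fin d)) :=
      continuous_subtype_val.comp ((continuous_eval_const t).comp continuous_fst)
    have := hev a
    have := hev b
    fun_prop
  · exact continuous_const

end IsDrivenBy

/-- A form of the Arzelà–Ascoli theorem. -/
lemma isCompact_setOf_lipschitzWith {X Y : Type*} [PseudoMetricSpace X] [MetricSpace Y]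
    [CompactSpace Y] (M : ℝ≥0) : IsCompact {f : C(X, Y) | LipschitzWith M f} := by
  refine ArzelaAscoli.isCompact_of_equicontinuous _ ?_ ?_
  · have : ContinuousMap.toFun '' {f : C(X, Y) | LipschitzWith M f} =
        {f : X → Y | LipschitzWith M f} := by
      ext f
      exact ⟨by rintro ⟨g, hg, rfl⟩; exact hg, fun hf => ⟨⟨f, hf.continuous⟩, hf, rfl⟩⟩
    rw [this]
    exact (isClosed_setOfPred_lipschitzWith M).isCompact
  · exact (LipschitzWith.uniformEquicontinuous _ M fun f => f.2).equicontinuous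

lemma isCompact_setOf_isDrivenBy (hZ : IsCompact Z) (hΨ : ∀ i, Continuous (Ψ i)) :
    IsCompact {x : C(ℝ≥0, Z) | ∃ U, IsCumulativeLaw U ∧ IsDrivenBy Ψ x U} := by
  have : CompactSpace Z := isCompact_iff_compactSpace.1 hZ
  obtain ⟨M, hM⟩ : ∃ M : ℝ≥0, ∀ i z, ‖Ψ i z‖ < M := by
    have (i : Fin N) : ∃ M : ℝ≥0, ∀ z, ‖Ψ i z‖ < M := by
      obtain ⟨C, hC⟩ := isCompact_univ.exists_bound_of_continuousOn (hΨ i).continuousOn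
      refine ⟨C.toNNReal + 1, fun z => ?_⟩
      push_cast
      linarith [hC z trivial, Real.le_coe_toNNReal C]
    choose M hM using this
    exact ⟨Finset.univ.sup M, fun i z => (hM i z).trans_le
      (NNReal.coe_le_coe.2 (Finset.le_sup (Finset.mem_univ i)))⟩
  have hc : IsCompact (({x : C(ℝ≥0, Z) | LipschitzWith M x} ×ˢ
      {U : Fin N → ℝ≥0 → ℝ | IsCumulativeLaw U}) ∩ {p | IsDrivenBy Ψ p.1 p.2}) :=
    ((isCompact_setOf_lipschitzWith M).prod IsCumulativeLaw.isCompact).inter_right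
      (IsDrivenBy.isClosed hΨ)
  convert hc.image continuous_fst using 1
  ext x
  constructor
  · rintro ⟨U, hU, hx⟩
    exact ⟨(x, U), ⟨⟨hx.lipschitzWith hM, hU⟩, hx⟩, rfl⟩
  · rintro ⟨⟨x, U⟩, ⟨⟨-, hU⟩, hx⟩, rfl⟩
    exact ⟨U, hU, hx⟩

namespace IsSwitchingLaw

variable {u : Fin N → ℝ → ℝ}

lemma ae_mem (hu : IsSwitchingLaw u) :
    ∀ᵐ s, 0 ≤ s → (∀ i, u i s ∈ Set.Icc (0 : ℝ) 1) ∧ ∑ i, u i s = 1 :=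
  (ae_restrict_iff' measurableSet_Ici).1 hu.2

lemma intervalIntegrable (hu : IsSwitchingLaw u) (i : Fin N) {a b : ℝ} (ha : 0 ≤ a) (hb : 0 ≤ b) :
    IntervalIntegrable (u i) volume a b := by
  refine (intervalIntegrable_const (c := (1 : ℝ))).mono_fun (hu.1 i).aestronglyMeasurable ?_
  filter_upwards [ae_restrict_of_ae hu.ae_mem, ae_restrict_mem measurableSet_uIoc] with s hs hsab
  have := (hs ((le_min ha hb).trans hsab.1.le)).1 i
  simpa [abs_of_nonneg this.1] using this.2

lemma integral_nonneg (hu : IsSwitchingLaw u) (i : Fin N) {a b : ℝ} (ha : 0 ≤ a) (hab : a ≤ b) :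
    0 ≤ ∫ s in a..b, u i s := by
  refine intervalIntegral.integral_nonneg_of_ae_restrict hab ?_
  filter_upwards [ae_restrict_of_ae hu.ae_mem, ae_restrict_mem measurableSet_Icc] with s hs hsab
  exact ((hs (ha.trans hsab.1)).1 i).1

lemma sum_integral (hu : IsSwitchingLaw u) {a b : ℝ} (ha : 0 ≤ a) (hab : a ≤ b) :
    ∑ i, ∫ s in a..b, u i s = b - a := by
  rw [← intervalIntegral.integral_finsetSum fun i _ =>
    hu.intervalIntegrable i ha (ha.trans hab)]
  trans ∫ _ in a..b, (1 : ℝ)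
  · refine intervalIntegral.integral_congr_ae ?_
    filter_upwards [hu.ae_mem] with s hs hsab
    rw [Set.uIoc_of_le hab] at hsab
    exact (hs (ha.trans hsab.1.le)).2
  · simp

/-- A switching law integrates to a cumulative law. -/
lemma isCumulativeLaw (hu : IsSwitchingLaw u) :
    IsCumulativeLaw fun i (t : ℝ≥0) => ∫ s in (0 : ℝ)..t, u i s where
  monotone i a b hab := by
    beta_reduce
    rw [← sub_nonneg, intervalIntegral.integral_interval_sub_left
      (hu.intervalIntegrable i le_rfl b.coe_nonneg) (hu.intervalIntegrable i le_rfl a.coe_nonneg)]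
    exact hu.integral_nonneg i a.coe_nonneg hab
  nonneg i t := hu.integral_nonneg i le_rfl t.2
  sum_eq t := by simpa using hu.sum_integral le_rfl t.2

lemma intervalIntegrable_sum_smul {E : Type*} [NormedAddCommGroup E] [NormedSpace ℝ E]
    (hu : IsSwitchingLaw u) {g : Fin N → ℝ → E} (hg : ∀ i, Continuous (g i)) {a b : ℝ}
    (ha : 0 ≤ a) (hb : 0 ≤ b) :
    IntervalIntegrable (fun s => ∑ i, u i s • g i s) volume a b := by
  have := IntervalIntegrable.sum Finset.univ fun i _ =>
    (hu.intervalIntegrable i ha hb).smul_continuousOn (hg i).continuousOn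
  simpa [Finset.sum_fn] using this

/-- If each `gᵢ` is `ε`-close to `vᵢ`, then `∫ ∑ uᵢ gᵢ` is close to `∑ (∫ uᵢ) vᵢ`. -/
lemma norm_integral_sub_le {E : Type*} [NormedAddCommGroup E] [NormedSpace ℝ E] [CompleteSpace E]
    (hu : IsSwitchingLaw u) {g : Fin N → ℝ → E} (hg : ∀ i, Continuous (g i)) {v : Fin N → E}
    {a b ε : ℝ} (ha : 0 ≤ a) (hab : a ≤ b) (h : ∀ s ∈ Set.Icc a b, ∀ i, ‖g i s - v i‖ ≤ ε) :
    ‖(∫ s in a..b, ∑ i, u i s • g i s) - ∑ i, (∫ s in a..b, u i s) • v i‖ ≤ ε * (b - a) := by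
  have hb := ha.trans hab
  simp_rw [← intervalIntegral.integral_smul_const]
  rw [← intervalIntegral.integral_finsetSum fun i _ =>
      (hu.intervalIntegrable i ha hb).smul_continuousOn continuousOn_const,
    ← intervalIntegral.integral_sub (hu.intervalIntegrable_sum_smul hg ha hb)
      (hu.intervalIntegrable_sum_smul (fun _ => continuous_const) ha hb),
    ← abs_of_nonneg (sub_nonneg.2 hab)]
  refine intervalIntegral.norm_integral_le_of_norm_le_const_ae ?_
  filter_upwards [hu.ae_mem] with s hs hsab
  rw [Set.uIoc_of_le hab] at hsab
  obtain ⟨hs₀, hs₁⟩ := hs (ha.trans hsab.1.le)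
  simp_rw [← Finset.sum_sub_distrib, ← smul_sub]
  calc ‖∑ i, u i s • (g i s - v i)‖ ≤ ∑ i, u i s * ε := norm_sum_le_of_le _ fun i _ => by
        rw [norm_smul, Real.norm_of_nonneg (hs₀ i).1]
        exact mul_le_mul_of_nonneg_left (h s ⟨hsab.1.le, hsab.2⟩ i) (hs₀ i).1
    _ = ε := by rw [← Finset.sum_mul, hs₁, one_mul]

end IsSwitchingLaw

namespace IsCumulativeLaw

variable {U : Fin N → ℝ≥0 → ℝ}

lemma lipschitzWith_comp_toNNReal (hU : IsCumulativeLaw U) (i : Fin N) :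
    LipschitzWith 1 fun t : ℝ => U i t.toNNReal := by
  simpa [Function.comp_def] using (hU.lipschitzWith i).comp Real.lipschitzWith_toNNReal

/-- A cumulative law differentiates to a switching law. -/
lemma isSwitchingLaw_deriv (hU : IsCumulativeLaw U) :
    IsSwitchingLaw fun i => deriv fun t : ℝ => U i t.toNNReal := by
  refine ⟨fun i => measurable_deriv _, ?_⟩
  have hdiff : ∀ᵐ s : ℝ, ∀ i, DifferentiableAt ℝ (fun t : ℝ => U i t.toNNReal) s :=
    ae_all_iff.2 fun i => (hU.lipschitzWith_comp_toNNReal i).ae_differentiableAt_real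
  filter_upwards [ae_restrict_of_ae hdiff, ae_restrict_mem measurableSet_Ici,
    ae_restrict_of_ae (Measure.ae_ne volume (0 : ℝ))] with s hs hs₀ hs₁
  refine ⟨fun i => ⟨?_, ?_⟩, ?_⟩
  · exact ((hU.monotone i).comp @Real.toNNReal_mono).deriv_nonneg
  · simpa using (le_abs_self _).trans
      (norm_deriv_le_of_lipschitz (hU.lipschitzWith_comp_toNNReal i) (x₀ := s))
  · have hsum := (HasDerivAt.fun_sum fun i (_ : i ∈ Finset.univ) => (hs i).hasDerivAt).deriv
    rw [← hsum]
    have : (fun t : ℝ => ∑ i, U i t.toNNReal) =ᶠ[𝓝 s] id := by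
      filter_upwards [lt_mem_nhds (lt_of_le_of_ne hs₀ hs₁.symm)] with t ht
      rw [hU.sum_eq, Real.coe_toNNReal _ ht.le, id]
    rw [this.deriv_eq, deriv_id]

lemma integral_deriv (hU : IsCumulativeLaw U) (i : Fin N) (a b : ℝ) :
    ∫ s in a..b, deriv (fun t : ℝ => U i t.toNNReal) s = U i b.toNNReal - U i a.toNNReal :=
  ((hU.lipschitzWith_comp_toNNReal i).lipschitzOnWith
    (s := Set.uIcc a b)).absolutelyContinuousOnInterval.integral_deriv_eq_sub

end IsCumulativeLaw

lemma mem_trajectoriesIn_iff (hΨ : ∀ i, Continuous (Ψ i)) {x : C(ℝ≥0, Z)} :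
    x ∈ trajectoriesIn Z Ψ ↔ ∃ U, IsCumulativeLaw U ∧ IsDrivenBy Ψ x U := by
  have hg (i : Fin N) : Continuous fun s : ℝ => Ψ i (x s.toNNReal) :=
    (hΨ i).comp (x.continuous.comp continuous_real_toNNReal)
  simp only [trajectoriesIn, Set.mem_ofPred_eq]
  simp_rw [← intervalIntegral.integral_of_le (NNReal.coe_nonneg _)]
  constructor
  · rintro ⟨u, hu, hx⟩
    refine ⟨_, hu.isCumulativeLaw, fun a b hab v ε h => ?_⟩
    have hab' : (a : ℝ) ≤ b := hab
    have key := hu.norm_integral_sub_le hg (v := v) (ε := ε) a.coe_nonneg hab' fun s hs i =>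
      (h s.toNNReal ⟨NNReal.le_toNNReal_of_coe_le hs.1, Real.toNNReal_le_iff_le_coe.2 hs.2⟩ i).le
    have hincr (i : Fin N) := intervalIntegral.integral_interval_sub_left
      (hu.intervalIntegrable i le_rfl b.coe_nonneg) (hu.intervalIntegrable i le_rfl a.coe_nonneg)
    simp only [hincr]
    rwa [hx b, hx a, add_sub_add_left_eq_sub, intervalIntegral.integral_interval_sub_left
      (hu.intervalIntegrable_sum_smul hg le_rfl b.coe_nonneg)
      (hu.intervalIntegrable_sum_smul hg le_rfl a.coe_nonneg)]
  · rintro ⟨U, hU, hx⟩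
    have hu := hU.isSwitchingLaw_deriv
    refine ⟨_, hu, fun T => ?_⟩
    set F : ℝ → EuclideanSpace ℝ (Fin d) :=
      fun s => ∑ i, deriv (fun t : ℝ => U i t.toNNReal) s • Ψ i (x s.toNNReal)
    set f : ℝ → EuclideanSpace ℝ (Fin d) := fun t => x t.toNNReal - ∫ s in (0 : ℝ)..t, F s with hf
    have hFint (a b : ℝ) (ha : 0 ≤ a) (hb : 0 ≤ b) : IntervalIntegrable F volume a b :=
      hu.intervalIntegrable_sum_smul hg ha hb
    have hcont : ContinuousOn f (Set.Icc 0 T) := by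
      refine (continuous_subtype_val.comp
        (x.continuous.comp continuous_real_toNNReal)).continuousOn.sub ?_
      have := intervalIntegral.continuousOn_primitive_interval'
        (hFint 0 T le_rfl T.coe_nonneg) Set.left_mem_uIcc
      rwa [Set.uIcc_of_le T.coe_nonneg] at this
    have hderiv : ∀ a ∈ Set.Ico (0 : ℝ) T, HasDerivWithinAt f 0 (Set.Ici a) a := by
      intro a ha
      rw [hasDerivWithinAt_iff_isLittleO, Asymptotics.isLittleO_iff]
      intro c hc
      have hclose : ∀ᶠ s in 𝓝 a, ∀ i, ‖Ψ i (x s.toNNReal) - Ψ i (x a.toNNReal)‖ < c / 2 :=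
        eventually_all.2 fun i => by
          simpa [dist_eq_norm] using Metric.tendsto_nhds.1 ((hg i).tendsto a) (c / 2) (half_pos hc)
      obtain ⟨δ, hδ, hball⟩ := Metric.eventually_nhds_iff.1 hclose
      filter_upwards [self_mem_nhdsWithin, mem_nhdsWithin_of_mem_nhds (Metric.ball_mem_nhds a hδ)]
        with b (hab : a ≤ b) hb
      have hb₀ : 0 ≤ b := ha.1.trans hab
      have hnear : ∀ s ∈ Set.Icc a b, ∀ i, ‖Ψ i (x s.toNNReal) - Ψ i (x a.toNNReal)‖ < c / 2 := by
        intro s hs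
        refine hball ?_
        rw [Metric.mem_ball, Real.dist_eq, abs_of_nonneg (sub_nonneg.2 hab)] at hb
        rw [Real.dist_eq, abs_of_nonneg (sub_nonneg.2 hs.1)]
        linarith [hs.2]
      have h₁ := hx a.toNNReal b.toNNReal (Real.toNNReal_mono hab) (fun i => Ψ i (x a.toNNReal))
        (c / 2) fun s hs i => by
          simpa using hnear s ⟨Real.toNNReal_le_iff_le_coe.1 hs.1,
            (Real.le_toNNReal_iff_coe_le hb₀).1 hs.2⟩ i
      have h₂ := hu.norm_integral_sub_le hg (v := fun i => Ψ i (x a.toNNReal)) ha.1 hab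
        fun s hs i => (hnear s hs i).le
      simp only [hU.integral_deriv] at h₂
      rw [Real.coe_toNNReal _ hb₀, Real.coe_toNNReal _ ha.1] at h₁
      rw [smul_zero, sub_zero, Real.norm_of_nonneg (sub_nonneg.2 hab)]
      calc ‖f b - f a‖ = _ := congrArg norm ?_
        _ ≤ _ := norm_sub_le_of_le h₁ h₂
        _ = c * (b - a) := by ring
      rw [← intervalIntegral.integral_interval_sub_left (hFint 0 b le_rfl hb₀)
        (hFint 0 a le_rfl ha.1)]
      simp only [hf]
      abel
    have := constant_of_has_deriv_right_zero hcont hderiv T ⟨T.coe_nonneg, le_rfl⟩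
    simpa [hf, sub_eq_iff_eq_add] using this

end SwitchedSystems

/-- The trajectories of a switched system of continuous vector fields on a compact set
`Z ⊆ ℝ^d` form a switched Bebutov shift. -/
theorem trajectories_form_switched_bebutov
    (d N : ℕ) (Z : Set (EuclideanSpace ℝ (Fin d))) (hZc : IsCompact Z)
    (Ψ : Fin N → Z → EuclideanSpace ℝ (Fin d)) (hΨ : ∀ i, Continuous (Ψ i)) :
    IsSwitchedBebutovShift (trajectoriesIn Z Ψ) := by
  have hmem {x : C(ℝ≥0, Z)} := mem_trajectoriesIn_iff hΨ (x := x)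
  refine ⟨?_, fun φ hφ τ => ?_, fun φ₁ h₁ φ₂ h₂ τ _ _ ψ hψ₁ hψ₂ => ?_⟩
  · convert isCompact_setOf_isDrivenBy hZc hΨ using 1
    exact Set.ext fun _ => hmem
  · obtain ⟨U, hU, hφ⟩ := hmem.1 hφ
    exact hmem.2 ⟨_, hU.shift τ, hφ.shift τ⟩
  · obtain ⟨U, hU, h₁⟩ := hmem.1 h₁
    obtain ⟨V, hV, h₂⟩ := hmem.1 h₂
    exact hmem.2 ⟨_, hU.switch hV τ, h₁.switch h₂ hψ₁ hψ₂⟩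
end
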